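/- arXiv:1203.0851 — 5 statements merged into one kernel-verified Lean document; each statement's English description precedes it below -/
import Mathlib

section
/- Let n ≥ 2 and let C ⊆ ℝⁿ be a continuum (nonempty compact connected set). Assume there exists an affine hyperplane B ⊆ ℝⁿ (an (n−1)-dimensional affine subspace) such that B ∩ C = {p} for a single point p, the set C \ {p} is connected, and for every x, y ∈ C \ {p} there exists an open neighbourhood U of p such that d̃(x, y, C \ U) < ∞. Then there exists a topological embedding h : C → ℝⁿ (a continuous injection, automatically an embedding since C is compact) such that h(C) is not the attractor of any iterated function system on ℝⁿ, i.e., there is no finite family f₁, …, f_m : ℝⁿ → ℝⁿ of contractions with h(C) = f₁(h(C)) ∪ ⋯ ∪ f_m(h(C)). -/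
open scoped ENNReal NNReal

/-- `chainDistEps A x y ε` is the infimum over all finite chains `x = x₀, x₁, …, x_k = y`
of points of `A` with consecutive distances `< ε` of the sum `∑ dist (xᵢ) (xᵢ₊₁)`
(`∞` if no such chain exists). -/
noncomputable def chainDistEps {X : Type*} [MetricSpace X] (A : Set X) (x y : X) (ε : ℝ) :
    ℝ≥0∞ :=
  ⨅ (k : ℕ) (c : Fin (k + 1) → X) (_ : c 0 = x) (_ : c (Fin.last k) = y)
    (_ : ∀ i, c i ∈ A) (_ : ∀ i : Fin k, dist (c i.castSucc) (c i.succ) < ε),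
    ∑ i : Fin k, ENNReal.ofReal (dist (c i.castSucc) (c i.succ))

/-- `chainDist A x y` is `d̃(x,y,A)`, the limit of `chainDistEps A x y ε` as `ε → 0⁺`;
since `ε ↦ chainDistEps A x y ε` is antitone in `ε`, this limit equals the supremum
over `ε > 0`. -/
noncomputable def chainDist {X : Type*} [MetricSpace X] (A : Set X) (x y : X) : ℝ≥0∞ :=
  ⨆ (ε : ℝ) (_ : 0 < ε), chainDistEps A x y ε

section ChainDist

open Set Filter Topology

variable {X Y : Type*} [MetricSpace X] [MetricSpace Y]

lemma chainDistEps_le_sum {A : Set X} {ε : ℝ} {k : ℕ} (c : Fin (k + 1) → X)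
    (hA : ∀ i, c i ∈ A) (hε : ∀ i : Fin k, dist (c i.castSucc) (c i.succ) < ε) :
    chainDistEps A (c 0) (c (Fin.last k)) ε
      ≤ ∑ i : Fin k, ENNReal.ofReal (dist (c i.castSucc) (c i.succ)) :=
  iInf_le_of_le k <| iInf_le_of_le c <| iInf_le_of_le rfl <| iInf_le_of_le rfl <|
    iInf_le_of_le hA <| iInf_le_of_le hε le_rfl

lemma le_chainDistEps {A : Set X} {x y : X} {ε : ℝ} {r : ℝ≥0∞}
    (h : ∀ (k : ℕ) (c : Fin (k + 1) → X), c 0 = x → c (Fin.last k) = y → (∀ i, c i ∈ A) →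
      (∀ i : Fin k, dist (c i.castSucc) (c i.succ) < ε) →
      r ≤ ∑ i : Fin k, ENNReal.ofReal (dist (c i.castSucc) (c i.succ))) :
    r ≤ chainDistEps A x y ε :=
  le_iInf fun k => le_iInf fun c => le_iInf fun h₀ => le_iInf fun h₁ => le_iInf fun hA =>
    le_iInf fun hε => h k c h₀ h₁ hA hε

lemma chainDistEps_le_chainDist (A : Set X) (x y : X) {ε : ℝ} (hε : 0 < ε) :
    chainDistEps A x y ε ≤ chainDist A x y :=
  le_iSup₂_of_le ε hε le_rfl

lemma chainDistEps_self {A : Set X} {x : X} (hx : x ∈ A) (ε : ℝ) : chainDistEps A x x ε = 0 := by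
  simpa using chainDistEps_le_sum (A := A) (ε := ε) (k := 0) (fun _ => x) (fun _ => hx)
    (fun i => i.elim0)

lemma chainDist_self {A : Set X} {x : X} (hx : x ∈ A) : chainDist A x x = 0 := by
  simp [chainDist, chainDistEps_self hx]

lemma chainDistEps_le_dist_add {A : Set X} {x y z : X} {ε : ℝ} (hx : x ∈ A) (hxy : dist x y < ε) :
    chainDistEps A x z ε ≤ ENNReal.ofReal (dist x y) + chainDistEps A y z ε := by
  rw [← tsub_le_iff_left]
  refine le_chainDistEps fun k c h₀ h₁ hA hε => ?_
  rw [tsub_le_iff_left]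
  have := chainDistEps_le_sum (A := A) (ε := ε) (k := k + 1) (Fin.cons x c : Fin (k + 1 + 1) → X)
    (fun i => by refine Fin.cases ?_ (fun j => ?_) i <;> simp [hx, hA])
    (fun i => by
      refine Fin.cases ?_ (fun j => ?_) i
      · simpa [h₀] using hxy
      · simpa [← Fin.succ_castSucc] using hε j)
  rw [Fin.sum_univ_succ] at this
  simpa [← Fin.succ_castSucc, ← Fin.succ_last, h₀, h₁] using this

lemma chainDistEps_le_sum_add {A : Set X} {z : X} {ε : ℝ} (k : ℕ) (c : Fin (k + 1) → X)
    (hA : ∀ i, c i ∈ A) (hε : ∀ i : Fin k, dist (c i.castSucc) (c i.succ) < ε) :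
    chainDistEps A (c 0) z ε ≤ ∑ i : Fin k, ENNReal.ofReal (dist (c i.castSucc) (c i.succ))
      + chainDistEps A (c (Fin.last k)) z ε := by
  induction k with
  | zero => simp
  | succ k ih =>
    have h := ih (Fin.tail c) (fun i => hA _) (fun i => hε i.succ)
    rw [Fin.sum_univ_succ]
    exact (chainDistEps_le_dist_add (hA 0) (hε 0)).trans
      ((add_le_add le_rfl h).trans_eq (add_assoc _ _ _).symm)

lemma chainDist_triangle (A : Set X) (x y z : X) :
    chainDist A x z ≤ chainDist A x y + chainDist A y z := by
  refine iSup₂_le fun ε hε => ?_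
  refine le_trans ?_ (add_le_add (chainDistEps_le_chainDist A x y hε)
    (chainDistEps_le_chainDist A y z hε))
  rw [← tsub_le_iff_right]
  refine le_chainDistEps fun k c h₀ h₁ hA hc => ?_
  rw [tsub_le_iff_right]
  subst h₀ h₁
  exact chainDistEps_le_sum_add k c hA hc

lemma LipschitzOnWith.chainDist_le {A : Set X} {B : Set Y} {f : X → Y} {L : ℝ≥0}
    (hf : LipschitzOnWith L f A) (hAB : MapsTo f A B) (hL : L ≠ 0) (x y : X) :
    chainDist B (f x) (f y) ≤ L * chainDist A x y := by
  have hL' : (0 : ℝ) < L := NNReal.coe_pos.2 (pos_iff_ne_zero.2 hL)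
  refine iSup₂_le fun ε hε => ?_
  refine le_trans ?_ (mul_le_mul_right (chainDistEps_le_chainDist A x y (div_pos hε hL')) _)
  rw [mul_comm, ← ENNReal.div_le_iff_le_mul (by simp [hL]) (by simp)]
  refine le_chainDistEps fun k c h₀ h₁ hA hc => ?_
  rw [ENNReal.div_le_iff_le_mul (by simp [hL]) (by simp), Finset.sum_mul]
  subst h₀ h₁
  have key (i : Fin k) : dist (f (c i.castSucc)) (f (c i.succ))
      ≤ dist (c i.castSucc) (c i.succ) * L := by
    rw [mul_comm]; exact hf.dist_le_mul _ (hA _) _ (hA _)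
  refine (chainDistEps_le_sum (f ∘ c) (fun i => hAB (hA i)) fun i => ?_).trans
    (Finset.sum_le_sum fun i _ => ?_)
  · exact (key i).trans_lt ((lt_div_iff₀ hL').1 (hc i))
  · rw [← ENNReal.ofReal_coe_nnreal, ← ENNReal.ofReal_mul dist_nonneg]
    exact ENNReal.ofReal_le_ofReal (key i)

lemma ofReal_sub_le_sum_dist {G : X → ℝ} (k : ℕ) (c : Fin (k + 1) → X)
    (h : ∀ i : Fin k, |G (c i.castSucc) - G (c i.succ)| ≤ dist (c i.castSucc) (c i.succ)) :
    ENNReal.ofReal (G (c (Fin.last k)) - G (c 0))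
      ≤ ∑ i : Fin k, ENNReal.ofReal (dist (c i.castSucc) (c i.succ)) := by
  rw [← ENNReal.ofReal_sum_of_nonneg fun _ _ => dist_nonneg]
  refine ENNReal.ofReal_le_ofReal ?_
  induction k with
  | zero => simp
  | succ k ih =>
    rw [Fin.sum_univ_castSucc]
    have h₁ := ih (fun i => c i.castSucc) (fun i => h i.castSucc)
    have h₂ := (neg_le_abs _).trans (h (Fin.last k))
    simp only [Fin.succ_last, Fin.castSucc_zero, Fin.succ_castSucc] at h₁ h₂ ⊢
    linarith

/-- On a compact set, the increment of a function that is locally `1`-Lipschitz bounds the chain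
distance from below. -/
lemma IsCompact.ofReal_sub_le_chainDist {K : Set X} (hK : IsCompact K) {G : X → ℝ}
    (hG : ∀ z ∈ K, ∃ V ∈ 𝓝 z, ∀ u ∈ V ∩ K, ∀ w ∈ V ∩ K, |G u - G w| ≤ dist u w) (x y : X) :
    ENNReal.ofReal (G y - G x) ≤ chainDist K x y := by
  choose! V hV hGV using hG
  obtain ⟨δ, hδ, h⟩ := lebesgue_number_lemma_of_metric (c := fun z : K => interior (V z)) hK
    (fun _ => isOpen_interior)
    (fun z hz => mem_iUnion.2 ⟨⟨z, hz⟩, mem_interior_iff_mem_nhds.2 (hV z hz)⟩)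
  refine le_trans (le_chainDistEps fun k c h₀ h₁ hA hc => ?_) (chainDistEps_le_chainDist K x y hδ)
  subst h₀ h₁
  refine ofReal_sub_le_sum_dist k c fun i => ?_
  obtain ⟨z, hz⟩ := h _ (hA i.castSucc)
  exact hGV z z.2 _ ⟨interior_subset (hz (Metric.mem_ball_self hδ)), hA _⟩ _
    ⟨interior_subset (hz (Metric.mem_ball'.2 (hc i))), hA _⟩

/-- A compact set with an accumulation point at infinite chain distance from the rest of the set,
the rest being at finite mutual chain distances, is not the attractor of an iterated function
system. -/
theorem not_attractor_of_tendsto_chainDist {K : Set X} (hK : IsCompact K) {q : X}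
    (hq : q ∈ K) (hacc : q ∈ closure (K \ {q}))
    (hfin : ∀ x ∈ K \ {q}, ∀ y ∈ K \ {q}, chainDist K x y < ⊤)
    (hinf : ∀ x ∈ K \ {q}, Tendsto (chainDist K x) (𝓝[K] q) (𝓝 ⊤)) {m : ℕ}
    (f : Fin m → X → X) (hf : ∀ i, ∃ lam : ℝ≥0, lam < 1 ∧ LipschitzWith lam (f i)) :
    K ≠ ⋃ i, f i '' K := by
  intro hKf
  have hmaps (i : Fin m) : MapsTo (f i) K K := fun x hx => by
    rw [hKf]; exact mem_iUnion.2 ⟨i, mem_image_of_mem _ hx⟩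
  have hcont (i : Fin m) : Continuous (f i) := by
    obtain ⟨lam, -, h⟩ := hf i
    exact h.continuous
  have hq_inf : ∀ x ∈ K \ {q}, chainDist K x q = ⊤ := fun x hx => by
    refine ENNReal.eq_top_of_forall_nnreal_le fun r => ?_
    exact (((hinf x hx).eventually (lt_mem_nhds (ENNReal.coe_lt_top (r := r)))).self_of_nhdsWithin
      hq).le
  -- Every map whose image contains `q` is constant on `K`.
  have hconst (i : Fin m) (hi : q ∈ f i '' K) : f i '' K ⊆ {q} := by
    obtain ⟨lam, hlam, hL⟩ := hf i
    obtain ⟨L, hL0, hL1, hL⟩ : ∃ L : ℝ≥0, L ≠ 0 ∧ L < 1 ∧ LipschitzWith L (f i) :=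
      ⟨max lam (1 / 2), (lt_max_of_lt_right (by norm_num)).ne',
        max_lt hlam (NNReal.half_lt_self one_ne_zero), hL.weaken (le_max_left _ _)⟩
    have hcd := (hL.lipschitzOnWith (s := K)).chainDist_le (hmaps i) hL0
    suffices h : MapsTo (f i) (K \ {q}) {q} by
      have h' := h.closure (hcont i)
      rw [closure_singleton] at h'
      rintro _ ⟨x, hx, rfl⟩
      by_cases hxq : x = q
      · rw [hxq]; exact h' hacc
      · exact h ⟨hx, hxq⟩
    intro x hx
    by_contra hne
    have hfx : f i x ∈ K \ {q} := ⟨hmaps i hx.1, hne⟩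
    obtain ⟨y, hy, hyq⟩ := hi
    by_cases hy' : y = q
    · subst hy'
      set c := chainDist K x (f i x)
      have hc : c ≠ ⊤ := (hfin x hx _ hfx).ne
      have h1L : (1 - L : ℝ≥0∞) ≠ 0 := (tsub_pos_of_lt (by exact_mod_cast hL1)).ne'
      have hA : c / (1 - L) ≠ ⊤ := ENNReal.div_ne_top hc h1L
      have hbound (k : ℕ) : chainDist K x ((f i)^[k] x) ≤ c / (1 - L) := by
        induction k with
        | zero => simp [chainDist_self hx.1]
        | succ k ih =>
          rw [Function.iterate_succ_apply']
          calc chainDist K x (f i ((f i)^[k] x))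
              ≤ c + chainDist K (f i x) (f i ((f i)^[k] x)) := chainDist_triangle _ _ _ _
            _ ≤ c + L * (c / (1 - L)) := by
                gcongr
                exact (hcd _ _).trans (by gcongr)
            _ = (1 - L) * (c / (1 - L)) + L * (c / (1 - L)) := by
                rw [ENNReal.mul_div_cancel h1L (by simp)]
            _ = c / (1 - L) := by
                rw [← add_mul, tsub_add_cancel_of_le (by exact_mod_cast hL1.le), one_mul]
      have hlim : Tendsto (fun k => (f i)^[k] x) atTop (𝓝[K] y) := by
        refine tendsto_nhdsWithin_iff.2 ⟨?_, Eventually.of_forall fun k => (hmaps i).iterate k hx.1⟩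
        rw [tendsto_iff_dist_tendsto_zero]
        refine squeeze_zero (g := fun k : ℕ => (L : ℝ) ^ k * dist x y) (fun _ => dist_nonneg)
          (fun k => ?_) ?_
        · simpa [Function.iterate_fixed hyq k] using (hL.iterate k).dist_le_mul x y
        · simpa using (tendsto_pow_atTop_nhds_zero_of_lt_one L.2 hL1).mul_const (dist x y)
      exact hA (top_le_iff.1 (le_of_tendsto' ((hinf x hx).comp hlim) hbound))
    · have h := hcd x y
      rw [hyq, hq_inf _ hfx, top_le_iff] at h
      exact ENNReal.mul_ne_top (by simp) (hfin x hx y ⟨hy, hy'⟩).ne h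
  -- Hence `K \ {q}` lies in a closed set missing `q`.
  have hclosed : IsClosed (⋃ i ∈ {i : Fin m | q ∉ f i '' K}, f i '' K) :=
    (toFinite _).isClosed_biUnion fun i _ => (hK.image (hcont i)).isClosed
  have hsub : K \ {q} ⊆ ⋃ i ∈ {i : Fin m | q ∉ f i '' K}, f i '' K := by
    rintro x ⟨hx, hxq⟩
    have hx' := hx
    rw [hKf] at hx'
    obtain ⟨i, hi⟩ := mem_iUnion.1 hx'
    exact mem_biUnion (show q ∉ f i '' K from fun h => hxq (hconst i h hi)) hi
  obtain ⟨i, hi, hqi⟩ := mem_iUnion₂.1 (closure_minimal hsub hclosed hacc)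
  exact hi hqi

end ChainDist

section Zigzag

open Set Filter Topology

/-- A potential that measures the horizontal travel `u` while the height `s` drops from `1 / j`
to `1 / (j + 1)`, truncated so as to be constant near and outside the ends of this range. -/
noncomputable def zigzagPotential (j : ℕ) (s u : ℝ) : ℝ :=
  if s ≤ 1 / (j + 1) then 1 / (4 * (j + 1))
  else if 1 / j ≤ s then -(1 / (4 * (j + 1)))
  else max (-(1 / (4 * (j + 1)))) (min (1 / (4 * (j + 1))) ((-1) ^ (j + 1) * u))

lemma zigzagPotential_of_le {j : ℕ} {s : ℝ} (hs : s ≤ 1 / (j + 1)) (u : ℝ) :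
    zigzagPotential j s u = 1 / (4 * (j + 1)) := if_pos hs

lemma zigzagPotential_of_ge {j : ℕ} (hj : 0 < j) {s : ℝ} (hs : 1 / j ≤ s) (u : ℝ) :
    zigzagPotential j s u = -(1 / (4 * (j + 1))) := by
  have : (1 : ℝ) / (j + 1) < 1 / j := by
    have : (0 : ℝ) < j := by exact_mod_cast hj
    gcongr; linarith
  rw [zigzagPotential, if_neg (by linarith), if_pos hs]

lemma abs_zigzagPotential_sub_le {j : ℕ} {s s' : ℝ} (hs : s ∈ Ioo (1 / (j + 1) : ℝ) (1 / j))
    (hs' : s' ∈ Ioo (1 / (j + 1) : ℝ) (1 / j)) (u u' : ℝ) :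
    |zigzagPotential j s u - zigzagPotential j s' u'| ≤ |u - u'| := by
  rw [zigzagPotential, if_neg (by linarith [hs.1]), if_neg (by linarith [hs.2]), zigzagPotential,
    if_neg (by linarith [hs'.1]), if_neg (by linarith [hs'.2])]
  refine (abs_max_sub_max_le_max _ _ _ _).trans (max_le (by simp) ?_)
  refine (abs_min_sub_min_le_max _ _ _ _).trans (max_le (by simp) ?_)
  rw [← mul_sub, abs_mul, abs_neg_one_pow, one_mul]

lemma lt_neg_one_pow_mul {m : ℕ} {R s u : ℝ} (hm : 0 < m) (hR : 2 * R < m) (hs : s = 1 / m)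
    (h : |u - s * Real.cos (Real.pi / s)| ≤ R * s ^ 2) : 1 / (2 * m) < (-1) ^ m * u := by
  have hm' : (0 : ℝ) < m := by exact_mod_cast hm
  have hcos : Real.cos (Real.pi / s) = (-1) ^ m := by
    rw [hs, div_div_eq_mul_div, div_one, mul_comm, Real.cos_nat_mul_pi]
  have hlt : R * s ^ 2 < 1 / m - 1 / (2 * m) := by
    rw [hs]; field_simp; linarith
  rw [hcos] at h
  subst hs
  rw [abs_le] at h
  rcases neg_one_pow_eq_or ℝ m with h₁ | h₁ <;> rw [h₁] at h ⊢ <;> linarith [h.1, h.2]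

variable {X : Type*} [MetricSpace X]

lemma eventually_zigzagPotential_eq {s u : X → ℝ} (hs : Continuous s) (hu : Continuous u) {j : ℕ}
    {R : ℝ} (hj : 0 < j) (hR : 2 * R < j) {z : X}
    (h : |u z - s z * Real.cos (Real.pi / s z)| ≤ R * s z ^ 2)
    (hz : s z ∉ Ioo (1 / (j + 1) : ℝ) (1 / j)) :
    ∀ᶠ w in 𝓝 z, zigzagPotential j (s w) (u w) = zigzagPotential j (s z) (u z) := by
  have hj' : (0 : ℝ) < j := by exact_mod_cast hj
  have hlt : (1 : ℝ) / (j + 1) < 1 / j := by gcongr; linarith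
  have ha : (0 : ℝ) < 1 / (4 * (j + 1)) := by positivity
  have hu' : Continuous fun w => (-1) ^ (j + 1) * u w := by fun_prop
  rcases lt_trichotomy (s z) (1 / (j + 1)) with h₁ | h₁ | h₁
  · filter_upwards [hs.continuousAt.eventually_lt continuousAt_const h₁] with w hw
    rw [zigzagPotential_of_le hw.le, zigzagPotential_of_le h₁.le]
  · have h₂ := lt_neg_one_pow_mul (m := j + 1) (by omega) (by push_cast; linarith)
      (by push_cast; exact h₁) h
    have h₃ : (1 : ℝ) / (4 * (j + 1)) < (-1) ^ (j + 1) * u z := by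
      refine lt_trans ?_ h₂
      push_cast
      gcongr; norm_num
    filter_upwards [hs.continuousAt.eventually_lt continuousAt_const (h₁.trans_lt hlt),
      continuousAt_const.eventually_lt hu'.continuousAt h₃] with w hw hw'
    rw [zigzagPotential_of_le h₁.le, zigzagPotential]
    split_ifs with h₄ h₅
    · rfl
    · linarith
    · rw [min_eq_left hw'.le, max_eq_right (by linarith)]
  · have h₅ : 1 / j ≤ s z := le_of_not_gt fun h₅ => hz ⟨h₁, h₅⟩
    rw [zigzagPotential_of_ge hj h₅]
    rcases h₅.lt_or_eq with h₅ | h₅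
    · filter_upwards [continuousAt_const.eventually_lt hs.continuousAt h₅] with w hw
      rw [zigzagPotential_of_ge hj hw.le]
    · have h₂ := lt_neg_one_pow_mul hj hR h₅.symm h
      have h₃ : (-1) ^ (j + 1) * u z < -(1 / (4 * (j + 1)) : ℝ) := by
        have : (1 : ℝ) / (4 * (j + 1)) < 1 / (2 * j) := by gcongr <;> linarith
        rw [pow_succ]
        linarith
      filter_upwards [continuousAt_const.eventually_lt hs.continuousAt h₁,
        hu'.continuousAt.eventually_lt continuousAt_const h₃] with w hw hw'
      rw [zigzagPotential]
      split_ifs with h₄ h₅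
      · linarith
      · rfl
      · rw [min_eq_right (by linarith), max_eq_left hw'.le]

lemma eq_of_mem_Ioo_one_div {i j : ℕ} {s : ℝ} (hi : 0 < i) (hj : 0 < j)
    (hsi : s ∈ Ioo (1 / (i + 1) : ℝ) (1 / i)) (hsj : s ∈ Ioo (1 / (j + 1) : ℝ) (1 / j)) :
    i = j := by
  have hi' : (0 : ℝ) < i := by exact_mod_cast hi
  have hj' : (0 : ℝ) < j := by exact_mod_cast hj
  have h₁ := lt_of_one_div_lt_one_div (by positivity) (hsj.1.trans hsi.2)
  have h₂ := lt_of_one_div_lt_one_div (by positivity) (hsi.1.trans hsj.2)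
  norm_cast at h₁ h₂
  omega

lemma exists_nhds_abs_sum_zigzagPotential_sub_le {s u : X → ℝ} (hs : Continuous s)
    (hu : LipschitzWith 1 u) {S : Finset ℕ} {R : ℝ} (hS : ∀ j ∈ S, 0 < j ∧ 2 * R < j) {z : X}
    (h : |u z - s z * Real.cos (Real.pi / s z)| ≤ R * s z ^ 2) :
    ∃ V ∈ 𝓝 z, ∀ w ∈ V, ∀ w' ∈ V, |∑ j ∈ S, zigzagPotential j (s w) (u w)
      - ∑ j ∈ S, zigzagPotential j (s w') (u w')| ≤ dist w w' := by
  have hconst : ∀ᶠ w in 𝓝 z, ∀ j ∈ S, s z ∉ Ioo (1 / (j + 1) : ℝ) (1 / j) →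
      zigzagPotential j (s w) (u w) = zigzagPotential j (s z) (u z) := by
    rw [Finset.eventually_all]
    intro j hj
    by_cases hz : s z ∈ Ioo (1 / (j + 1) : ℝ) (1 / j)
    · exact Eventually.of_forall fun w h => (h hz).elim
    · filter_upwards [eventually_zigzagPotential_eq hs hu.continuous (hS j hj).1 (hS j hj).2 h hz]
        with w hw _ using hw
  by_cases hz : ∃ i ∈ S, s z ∈ Ioo (1 / (i + 1) : ℝ) (1 / i)
  · obtain ⟨i, hi, hzi⟩ := hz
    refine ⟨_, hconst.and (hs.continuousAt.eventually_mem (isOpen_Ioo.mem_nhds hzi)),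
      fun w hw w' hw' => ?_⟩
    rw [← Finset.sum_sub_distrib, Finset.sum_eq_single i]
    · refine (abs_zigzagPotential_sub_le hw.2 hw'.2 _ _).trans ?_
      simpa [Real.dist_eq] using hu.dist_le_mul w w'
    · intro j hj hji
      have hzj : s z ∉ Ioo (1 / (j + 1) : ℝ) (1 / j) := fun hzj =>
        hji (eq_of_mem_Ioo_one_div (hS j hj).1 (hS i hi).1 hzj hzi)
      rw [hw.1 j hj hzj, hw'.1 j hj hzj, sub_self]
    · exact fun h => (h hi).elim
  · push Not at hz
    refine ⟨_, hconst, fun w hw w' hw' => ?_⟩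
    rw [Finset.sum_congr rfl fun j hj => hw j hj (hz j hj),
      Finset.sum_congr rfl fun j hj => hw' j hj (hz j hj)]
    simp

/-- In a compact set close to the zigzag `u = s * cos (π / s)`, points of positive height are
infinitely far from points of height zero in the chain distance. -/
theorem tendsto_chainDist_of_zigzag {K : Set X} (hK : IsCompact K) {s u : X → ℝ}
    (hs : Continuous s) (hu : LipschitzWith 1 u) {R : ℝ}
    (h : ∀ z ∈ K, |u z - s z * Real.cos (Real.pi / s z)| ≤ R * s z ^ 2) {x q : X}
    (hx : 0 < s x) (hq : s q = 0) : Tendsto (chainDist K x) (𝓝 q) (𝓝 ⊤) := by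
  obtain ⟨J₀, hJ₀⟩ := exists_nat_gt (max (2 * R) (1 / s x))
  have hJx : 1 / s x < J₀ := (le_max_right _ _).trans_lt hJ₀
  have hJR : 2 * R < J₀ := (le_max_left _ _).trans_lt hJ₀
  have hJ : (0 : ℝ) < J₀ := (one_div_pos.2 hx).trans hJx
  rw [ENNReal.tendsto_nhds_top_iff_nnreal]
  intro r
  have hdiv : Tendsto (fun J => ∑ j ∈ Finset.range J, 1 / ((j : ℝ) + 1)) atTop atTop :=
    Real.tendsto_sum_range_one_div_nat_succ_atTop
  obtain ⟨J, hJJ, hJr⟩ := ((eventually_ge_atTop J₀).and (hdiv.eventually_gt_atTop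
    (2 * r + ∑ j ∈ Finset.range J₀, 1 / ((j : ℝ) + 1)))).exists
  have hS : ∀ j ∈ Finset.Ico J₀ J, 0 < j ∧ 2 * R < j := fun j hj => by
    have h₁ := (Finset.mem_Ico.1 hj).1
    have h₂ : (J₀ : ℝ) ≤ j := by exact_mod_cast h₁
    exact ⟨by exact_mod_cast hJ.trans_le h₂, by linarith⟩
  have key := hK.ofReal_sub_le_chainDist
    (G := fun z => ∑ j ∈ Finset.Ico J₀ J, zigzagPotential j (s z) (u z)) (fun z hz => by
      obtain ⟨V, hV, hVG⟩ := exists_nhds_abs_sum_zigzagPotential_sub_le hs hu hS (h z hz)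
      exact ⟨V, hV, fun w hw w' hw' => hVG w hw.1 w' hw'.1⟩) x
  have hJpos : (0 : ℝ) < J := hJ.trans_le (by exact_mod_cast hJJ)
  filter_upwards [hs.continuousAt.eventually_lt continuousAt_const
    (hq.trans_lt (one_div_pos.2 hJpos))] with y hy
  refine lt_of_lt_of_le ?_ (key y)
  rw [← ENNReal.ofReal_coe_nnreal, ENNReal.ofReal_lt_ofReal_iff_of_nonneg r.coe_nonneg]
  have hGx : ∑ j ∈ Finset.Ico J₀ J, zigzagPotential j (s x) (u x)
      = ∑ j ∈ Finset.Ico J₀ J, -(1 / (4 * ((j : ℝ) + 1))) :=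
    Finset.sum_congr rfl fun j hj => by
      refine zigzagPotential_of_ge (hS j hj).1 ?_ _
      have h₂ : (J₀ : ℝ) ≤ j := by exact_mod_cast (Finset.mem_Ico.1 hj).1
      rw [one_div_le (by linarith) hx]
      linarith
  have hGy : ∑ j ∈ Finset.Ico J₀ J, zigzagPotential j (s y) (u y)
      = ∑ j ∈ Finset.Ico J₀ J, 1 / (4 * ((j : ℝ) + 1)) :=
    Finset.sum_congr rfl fun j hj => by
      refine zigzagPotential_of_le (hy.le.trans ?_) _
      have h₂ : ((j + 1 : ℕ) : ℝ) ≤ J := by exact_mod_cast (Finset.mem_Ico.1 hj).2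
      push_cast at h₂
      gcongr
  have hsum : ∑ j ∈ Finset.Ico J₀ J, 1 / (4 * ((j : ℝ) + 1))
      = (1 / 4) * ∑ j ∈ Finset.Ico J₀ J, 1 / ((j : ℝ) + 1) := by
    rw [Finset.mul_sum]
    exact Finset.sum_congr rfl fun j _ => by rw [one_div_mul_one_div]
  rw [hGx, hGy, Finset.sum_neg_distrib, hsum, Finset.sum_Ico_eq_sub _ hJJ]
  linarith

end Zigzag

section Embedding

open Set Filter Topology
open scoped InnerProductSpace

variable {E : Type*} [NormedAddCommGroup E] [InnerProductSpace ℝ E]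

/-- A hyperplane disjoint from a connected set has a unit normal pointing to the side on which the
set lies. -/
lemma exists_unit_normal_pos {n : ℕ} (hn : 1 ≤ n) [FiniteDimensional ℝ E]
    (hE : Module.finrank ℝ E = n) {B : AffineSubspace ℝ E}
    (hB : Module.finrank ℝ B.direction = n - 1) {p : E} (hp : p ∈ B) {S : Set E}
    (hS : IsConnected S) (hBS : Disjoint (B : Set E) S) :
    ∃ v ∈ B.directionᗮ, ‖v‖ = 1 ∧ ∀ x ∈ S, 0 < ⟪v, x - p⟫_ℝ := by
  have hrank : Module.finrank ℝ B.directionᗮ = 1 := by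
    have := B.direction.finrank_add_finrank_orthogonal
    omega
  obtain ⟨⟨w, hw⟩, hw0, hspan⟩ := finrank_eq_one_iff'.1 hrank
  have hw0' : w ≠ 0 := fun h => hw0 (Subtype.ext h)
  have hne : ∀ x ∈ S, ⟪w, x - p⟫_ℝ ≠ 0 := by
    intro x hx h
    refine disjoint_left.1 hBS ?_ hx
    have hdir : x - p ∈ B.direction := by
      rw [← Submodule.orthogonal_orthogonal B.direction, Submodule.mem_orthogonal]
      intro y hy
      obtain ⟨c, hc⟩ := hspan ⟨y, hy⟩
      have hc' : c • w = y := congrArg Subtype.val hc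
      rw [← hc', real_inner_smul_left, h, mul_zero]
    simpa using AffineSubspace.vadd_mem_of_mem_direction hdir hp
  have hcont : Continuous fun x => ⟪w, x - p⟫_ℝ := by fun_prop
  have himg := (hS.image _ hcont.continuousOn).isPreconnected.ordConnected
  have h0 : (0 : ℝ) ∉ (fun x => ⟪w, x - p⟫_ℝ) '' S := fun ⟨x, hx, h⟩ => hne x hx h
  obtain ⟨x₀, hx₀⟩ := hS.nonempty
  have key : ∃ a : ℝ, a ≠ 0 ∧ ∀ x ∈ S, 0 < a * ⟪w, x - p⟫_ℝ := by
    rcases lt_or_gt_of_ne (hne x₀ hx₀) with h | h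
    · refine ⟨-1, by norm_num, fun x hx => ?_⟩
      by_contra! hle
      exact h0 (himg.out (mem_image_of_mem _ hx₀) (mem_image_of_mem _ hx) ⟨h.le, by linarith⟩)
    · refine ⟨1, one_ne_zero, fun x hx => ?_⟩
      by_contra! hle
      exact h0 (himg.out (mem_image_of_mem _ hx) (mem_image_of_mem _ hx₀) ⟨by linarith, h.le⟩)
  obtain ⟨a, ha, hpos⟩ := key
  have haw : a • w ≠ 0 := smul_ne_zero ha hw0'
  refine ⟨(‖a • w‖⁻¹ : ℝ) • a • w, Submodule.smul_mem _ _ (Submodule.smul_mem _ _ hw),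
    norm_smul_inv_norm haw, fun x hx => ?_⟩
  rw [real_inner_smul_left, real_inner_smul_left]
  exact mul_pos (inv_pos.2 (norm_pos_iff.2 haw)) (hpos x hx)

/-- The map that squeezes a half-space onto a neighbourhood of the zigzag curve
`t ↦ t • v + (t * cos (π / t)) • e`, where `t` is the height above the boundary hyperplane
through `p` orthogonal to `v`. -/
noncomputable def zigzagMap (p v e x : E) : E :=
  ⟪v, x - p⟫_ℝ • v + (⟪v, x - p⟫_ℝ * Real.cos (Real.pi / ⟪v, x - p⟫_ℝ)) • e
    + ⟪v, x - p⟫_ℝ ^ 2 • (x - p - ⟪v, x - p⟫_ℝ • v)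

lemma continuous_mul_cos_pi_div : Continuous fun t : ℝ => t * Real.cos (Real.pi / t) := by
  rw [continuous_iff_continuousAt]
  intro t
  by_cases ht : t = 0
  · subst ht
    simp only [ContinuousAt, zero_mul]
    refine squeeze_zero_norm (a := fun t : ℝ => ‖t‖) (fun t => ?_) tendsto_norm_zero
    rw [norm_mul]
    exact mul_le_of_le_one_right (norm_nonneg _) (Real.abs_cos_le_one _)
  · exact continuousAt_id.mul
      (Real.continuous_cos.continuousAt.comp (continuousAt_const.div continuousAt_id ht))

lemma continuous_zigzagMap (p v e : E) : Continuous (zigzagMap p v e) := by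
  have ht : Continuous fun x => ⟪v, x - p⟫_ℝ := by fun_prop
  have h := continuous_mul_cos_pi_div.comp ht
  simp only [Function.comp_def] at h
  unfold zigzagMap
  fun_prop

lemma locallyLipschitzOn_zigzagMap (p v e : E) :
    LocallyLipschitzOn {x | ⟪v, x - p⟫_ℝ ≠ 0} (zigzagMap p v e) := by
  intro x hx
  have ht : ContDiffAt ℝ 1 (fun x => ⟪v, x - p⟫_ℝ) x :=
    contDiffAt_const.inner ℝ (contDiffAt_id.sub contDiffAt_const)
  have hdiv : ContDiffAt ℝ 1 (fun x => Real.pi / ⟪v, x - p⟫_ℝ) x := contDiffAt_const.div ht hx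
  have h : ContDiffAt ℝ 1 (zigzagMap p v e) x := by
    unfold zigzagMap
    fun_prop
  obtain ⟨L, V, hV, hL⟩ := h.exists_lipschitzOnWith
  exact ⟨L, V, mem_nhdsWithin_of_mem_nhds hV, hL⟩

@[simp]
lemma zigzagMap_self (p v e : E) : zigzagMap p v e p = 0 := by simp [zigzagMap]

lemma inner_normal_zigzagMap {v e : E} (hv : ‖v‖ = 1) (hve : ⟪v, e⟫_ℝ = 0) (p x : E) :
    ⟪v, zigzagMap p v e x⟫_ℝ = ⟪v, x - p⟫_ℝ := by
  simp [zigzagMap, inner_add_right, inner_sub_right, real_inner_smul_right, hv, hve]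

lemma inner_tangent_zigzagMap {v e : E} (he : ‖e‖ = 1) (hve : ⟪v, e⟫_ℝ = 0) (p x : E) :
    ⟪e, zigzagMap p v e x⟫_ℝ = ⟪v, x - p⟫_ℝ * Real.cos (Real.pi / ⟪v, x - p⟫_ℝ)
      + ⟪v, x - p⟫_ℝ ^ 2 * ⟪e, x - p⟫_ℝ := by
  rw [real_inner_comm] at hve
  simp [zigzagMap, inner_add_right, inner_sub_right, real_inner_smul_right, he, hve]

lemma zigzagMap_injOn {v e : E} (hv : ‖v‖ = 1) (hve : ⟪v, e⟫_ℝ = 0) {p : E} {C : Set E}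
    (hC : ∀ x ∈ C, x ≠ p → ⟪v, x - p⟫_ℝ ≠ 0) : InjOn (zigzagMap p v e) C := by
  intro x hx y hy hxy
  have ht : ⟪v, x - p⟫_ℝ = ⟪v, y - p⟫_ℝ := by
    rw [← inner_normal_zigzagMap hv hve p x, hxy, inner_normal_zigzagMap hv hve]
  by_cases h0 : ⟪v, x - p⟫_ℝ = 0
  · rw [not_imp_not.1 (hC x hx) h0, not_imp_not.1 (hC y hy) (ht ▸ h0)]
  · rw [zigzagMap, zigzagMap, ← ht] at hxy
    simpa using smul_right_injective E (pow_ne_zero 2 h0) (add_left_cancel hxy)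

lemma lipschitzWith_inner_left {v : E} (hv : ‖v‖ = 1) : LipschitzWith 1 fun z => ⟪v, z⟫_ℝ :=
  LipschitzWith.of_dist_le_mul fun x y => by
    rw [Real.dist_eq, ← inner_sub_right, dist_eq_norm]
    simpa [hv] using abs_real_inner_le_norm v (x - y)

/-- If `C \ {p}` is nonempty, has finite chain distances away from `p` and lies in the open
half-space with inner normal `v` at `p`, then `zigzagMap p v e` maps the continuum `C` to a set
which is not the attractor of an iterated function system. -/
theorem zigzagMap_image_not_attractor {v e : E} (hv : ‖v‖ = 1) (he : ‖e‖ = 1)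
    (hve : ⟪v, e⟫_ℝ = 0) {C : Set E} (hC : IsCompact C) (hconn : IsPreconnected C) {p : E}
    (hp : p ∈ C) (hne : (C \ {p}).Nonempty) (hpos : ∀ x ∈ C \ {p}, 0 < ⟪v, x - p⟫_ℝ)
    (hfin : ∀ x ∈ C \ {p}, ∀ y ∈ C \ {p},
      ∃ U : Set E, IsOpen U ∧ p ∈ U ∧ chainDist (C \ U) x y < ⊤) {m : ℕ}
    (f : Fin m → E → E) (hf : ∀ i, ∃ lam : ℝ≥0, lam < 1 ∧ LipschitzWith lam (f i)) :
    zigzagMap p v e '' C ≠ ⋃ i, f i '' (zigzagMap p v e '' C) := by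
  set h := zigzagMap p v e with hh
  have hcont : Continuous h := continuous_zigzagMap p v e
  have hinj : InjOn h C := zigzagMap_injOn hv hve fun x hx hxp => (hpos x ⟨hx, hxp⟩).ne'
  have hp0 : h p = 0 := zigzagMap_self p v e
  have hdiff : h '' C \ {0} = h '' (C \ {p}) := by
    rw [hinj.image_sdiff_subset (singleton_subset_iff.2 hp), image_singleton, hp0]
  refine not_attractor_of_tendsto_chainDist (q := 0) (hC.image hcont) ⟨p, hp, hp0⟩ ?_ ?_ ?_ f hf
  · obtain ⟨y, hy, hyp⟩ := hne
    have hacc := hconn.preperfect_of_nontrivial ⟨p, hp, y, hy, Ne.symm hyp⟩ p hp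
    rw [hdiff, ← hp0]
    exact image_closure_subset_closure_image hcont
      ⟨p, mem_closure_iff_clusterPt.2 (accPt_principal_iff_clusterPt.1 hacc), rfl⟩
  · rw [hdiff]
    rintro _ ⟨x, hx, rfl⟩ _ ⟨y, hy, rfl⟩
    obtain ⟨U, hU, hpU, hlt⟩ := hfin x hx y hy
    have hsub : C \ U ⊆ {x | ⟪v, x - p⟫_ℝ ≠ 0} := fun z hz =>
      (hpos z ⟨hz.1, fun hzp => hz.2 (by rwa [mem_singleton_iff.1 hzp])⟩).ne'
    obtain ⟨L, hL⟩ := ((locallyLipschitzOn_zigzagMap p v e).mono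
      hsub).exists_lipschitzOnWith_of_compact (hC.diff hU)
    have hle := (hL.weaken (le_add_of_nonneg_right zero_le_one : L ≤ L + 1)).chainDist_le
      (fun z hz => mem_image_of_mem h hz.1) (by positivity) x y
    exact hle.trans_lt (ENNReal.mul_lt_top (by simp) hlt)
  · rw [hdiff]
    rintro _ ⟨x, hx, rfl⟩
    obtain ⟨R, hR⟩ := (hC.image (continuous_id.sub continuous_const : Continuous fun x => x - p))
      |>.isBounded.exists_norm_le
    refine (tendsto_chainDist_of_zigzag (s := fun z => ⟪v, z⟫_ℝ) (u := fun z => ⟪e, z⟫_ℝ) (R := R)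
      (hC.image hcont) (lipschitzWith_inner_left hv).continuous (lipschitzWith_inner_left he) ?_ ?_
      (inner_zero_right v)).mono_left nhdsWithin_le_nhds
    · rintro _ ⟨z, hz, rfl⟩
      rw [hh, inner_normal_zigzagMap hv hve, inner_tangent_zigzagMap he hve, add_sub_cancel_left,
        abs_mul, abs_of_nonneg (sq_nonneg _), mul_comm]
      gcongr
      have h₁ := abs_real_inner_le_norm e (z - p)
      rw [he, one_mul] at h₁
      exact h₁.trans (hR _ (mem_image_of_mem _ hz))
    · rw [hh, inner_normal_zigzagMap hv hve]
      exact hpos x hx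

end Embedding

/-- Let `n ≥ 2` and `C ⊆ ℝⁿ` be a continuum. Suppose there is an
`(n-1)`-dimensional affine hyperplane `B` with `B ∩ C = {p}`, `C \ {p}` connected, and for all
`x, y ∈ C \ {p}` there is an open neighbourhood `U` of `p` with `d̃(x, y, C \ U) < ∞`.
Then there is a topological embedding `h` of `C` into `ℝⁿ` (a continuous injection on the
compact set `C`) such that `h(C)` is not the attractor of any IFS on `ℝⁿ`. -/
theorem exists_embedding_not_attractor (n : ℕ) (hn : 2 ≤ n)
    (C : Set (EuclideanSpace ℝ (Fin n))) (hCcomp : IsCompact C) (hCconn : IsConnected C)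
    (B : AffineSubspace ℝ (EuclideanSpace ℝ (Fin n)))
    (hBdim : Module.finrank ℝ B.direction = n - 1)
    (p : EuclideanSpace ℝ (Fin n)) (hBC : (B : Set (EuclideanSpace ℝ (Fin n))) ∩ C = {p})
    (hconn : IsConnected (C \ {p}))
    (hfin : ∀ x ∈ C \ {p}, ∀ y ∈ C \ {p},
      ∃ U : Set (EuclideanSpace ℝ (Fin n)), IsOpen U ∧ p ∈ U ∧ chainDist (C \ U) x y < ⊤) :
    ∃ h : EuclideanSpace ℝ (Fin n) → EuclideanSpace ℝ (Fin n),
      ContinuousOn h C ∧ Set.InjOn h C ∧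
      ¬ ∃ (m : ℕ) (f : Fin m → EuclideanSpace ℝ (Fin n) → EuclideanSpace ℝ (Fin n)),
          (∀ i, ∃ lam : ℝ≥0, lam < 1 ∧ LipschitzWith lam (f i)) ∧
          h '' C = ⋃ i, f i '' (h '' C) := by
  have hp : p ∈ (B : Set (EuclideanSpace ℝ (Fin n))) ∩ C := hBC ▸ Set.mem_singleton p
  have hdisj : Disjoint (B : Set (EuclideanSpace ℝ (Fin n))) (C \ {p}) :=
    Set.disjoint_left.2 fun x hxB hx => hx.2 (hBC ▸ ⟨hxB, hx.1⟩)
  obtain ⟨v, hvB, hv, hpos⟩ := exists_unit_normal_pos (by omega) finrank_euclideanSpace_fin hBdim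
    hp.1 hconn hdisj
  have : Nontrivial B.direction := Module.nontrivial_of_finrank_pos (R := ℝ) (by omega)
  obtain ⟨e, he⟩ := exists_norm_eq B.direction zero_le_one
  have hve : inner ℝ v (e : EuclideanSpace ℝ (Fin n)) = 0 :=
    B.direction.inner_left_of_mem_orthogonal e.2 hvB
  refine ⟨zigzagMap p v e, (continuous_zigzagMap p v _).continuousOn,
    zigzagMap_injOn hv hve fun x hx hxp => (hpos x ⟨hx, hxp⟩).ne', ?_⟩
  rintro ⟨m, f, hf, hKf⟩
  exact zigzagMap_image_not_attractor hv he hve hCcomp hCconn.isPreconnected hp.2 hconn.nonempty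
    hpos hfin f hf hKf
end

section
/- Let (K, d) be a compact metric space and p ∈ K a point such that d̃(x, y, K) < ∞ for all x, y ∈ K \ {p} and d̃(x, p, K) = ∞ for all x ∈ K \ {p}. If f : K → K is Lipschitz with some constant λ < 1 and p ∈ f(K), then f(K) = {p}, i.e., f is the constant map with value p. -/
open scoped ENNReal NNReal

/-- `HasChain ε L x y`: some chain of points from `x` to `y` with steps `< ε` has length `L`. -/
inductive HasChain {X : Type*} [MetricSpace X] (ε : ℝ) : ℝ≥0∞ → X → X → Prop
  | refl (x : X) : HasChain ε 0 x x
  | cons {L : ℝ≥0∞} {x y z : X} (h : dist x y < ε) (hc : HasChain ε L y z) :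
      HasChain ε (ENNReal.ofReal (dist x y) + L) x z

namespace HasChain

variable {X Y : Type*} [MetricSpace X] [MetricSpace Y] {ε : ℝ} {L M : ℝ≥0∞} {x y z : X}

theorem trans (h : HasChain ε L x y) (h' : HasChain ε M y z) : HasChain ε (L + M) x z := by
  induction h with
  | refl x => simpa using h'
  | cons hd _ ih => rw [add_assoc]; exact cons hd (ih h')

theorem single (h : dist x y < ε) : HasChain ε (ENNReal.ofReal (dist x y)) x y := by
  simpa using cons h (refl y)

/-- A contraction maps a chain to a chain whose length is scaled by at most its constant. -/
theorem map {f : X → Y} {lam : ℝ≥0} (hlam : lam ≤ 1) (hf : LipschitzWith lam f)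
    (h : HasChain ε L x y) : ∃ M ≤ lam * L, HasChain ε M (f x) (f y) := by
  induction h with
  | refl x => exact ⟨0, by simp, refl _⟩
  | @cons L x y z hd _ ih =>
    obtain ⟨M, hM, hc⟩ := ih
    have hfd := hf.dist_le_mul x y
    have hle : dist (f x) (f y) ≤ dist x y :=
      hfd.trans (mul_le_of_le_one_left dist_nonneg (by exact_mod_cast hlam))
    refine ⟨_, ?_, cons (hle.trans_lt hd) hc⟩
    rw [mul_add]
    gcongr
    rw [← edist_dist, ← edist_dist]
    exact hf x y

theorem chainDistEps_le (h : HasChain ε L x y) : chainDistEps Set.univ x y ε ≤ L := by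
  have key : ∃ (k : ℕ) (c : Fin (k + 1) → X), c 0 = x ∧ c (Fin.last k) = y ∧
      (∀ i : Fin k, dist (c i.castSucc) (c i.succ) < ε) ∧
      ∑ i : Fin k, ENNReal.ofReal (dist (c i.castSucc) (c i.succ)) = L := by
    induction h with
    | refl x => exact ⟨0, fun _ => x, rfl, rfl, fun i => i.elim0, by simp⟩
    | @cons L x y z hd _ ih =>
      obtain ⟨k, c, h0, h1, hs, hL⟩ := ih
      refine ⟨k + 1, Fin.cons x c, by simp, ?_, ?_, ?_⟩
      · rw [← Fin.succ_last, Fin.cons_succ, h1]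
      · intro i
        refine Fin.cases ?_ (fun i => ?_) i
        · simpa [h0] using hd
        · simpa [← Fin.succ_castSucc] using hs i
      · rw [Fin.sum_univ_succ]
        simp only [← Fin.succ_castSucc, Fin.cons_succ, Fin.castSucc_zero, Fin.cons_zero, h0, hL]
  obtain ⟨k, c, h0, h1, hs, rfl⟩ := key
  exact iInf_le_of_le k <| iInf_le_of_le c <| iInf_le_of_le h0 <| iInf_le_of_le h1 <|
    iInf_le_of_le (fun _ => Set.mem_univ _) <| iInf_le_of_le hs le_rfl

theorem of_fin (k : ℕ) (c : Fin (k + 1) → X)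
    (hs : ∀ i : Fin k, dist (c i.castSucc) (c i.succ) < ε) :
    HasChain ε (∑ i : Fin k, ENNReal.ofReal (dist (c i.castSucc) (c i.succ)))
      (c 0) (c (Fin.last k)) := by
  induction k with
  | zero => simpa using refl (c 0)
  | succ k ih =>
    rw [Fin.sum_univ_succ]
    exact cons (hs 0) (ih (fun i => c i.succ) fun i => hs i.succ)

end HasChain

theorem exists_hasChain_of_chainDistEps_lt {X : Type*} [MetricSpace X] {A : Set X} {x y : X}
    {ε : ℝ} {b : ℝ≥0∞} (h : chainDistEps A x y ε < b) : ∃ L < b, HasChain ε L x y := by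
  simp only [chainDistEps, iInf_lt_iff] at h
  obtain ⟨k, c, rfl, rfl, -, hs, hb⟩ := h
  exact ⟨_, hb, HasChain.of_fin k c hs⟩

/-- If `chainDist` is finite, there are chains of uniformly bounded length at every scale. -/
theorem exists_hasChain_of_chainDist_lt_top {X : Type*} [MetricSpace X] {A : Set X} {x y : X}
    (h : chainDist A x y < ⊤) :
    ∃ D : ℝ≥0, ∀ ε > 0, ∃ L ≤ (D : ℝ≥0∞), HasChain ε L x y := by
  obtain ⟨D, hD, -⟩ := ENNReal.lt_iff_exists_nnreal_btwn.1 h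
  refine ⟨D, fun ε hε => ?_⟩
  obtain ⟨L, hL, hc⟩ := exists_hasChain_of_chainDistEps_lt
    ((le_iSup₂ (f := fun ε (_ : 0 < ε) => chainDistEps A x y ε) ε hε).trans_lt hD)
  exact ⟨L, hL.le, hc⟩

theorem chainDist_lt_top_of_hasChain {X : Type*} [MetricSpace X] {x y : X} {D : ℝ≥0∞}
    (hD : D < ⊤) (h : ∀ ε > 0, ∃ L ≤ D, HasChain ε L x y) :
    chainDist Set.univ x y < ⊤ := by
  refine lt_of_le_of_lt (iSup₂_le fun ε hε => ?_) hD
  obtain ⟨L, hL, hc⟩ := h ε hε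
  exact hc.chainDistEps_le.trans hL

theorem chainDist_map_lt_top {X Y : Type*} [MetricSpace X] [MetricSpace Y] {A : Set X}
    {f : X → Y} {lam : ℝ≥0} (hlam : lam ≤ 1) (hf : LipschitzWith lam f) {x y : X}
    (h : chainDist A x y < ⊤) : chainDist Set.univ (f x) (f y) < ⊤ := by
  obtain ⟨D, hD⟩ := exists_hasChain_of_chainDist_lt_top h
  refine chainDist_lt_top_of_hasChain (D := lam * D)
    (ENNReal.mul_lt_top ENNReal.coe_lt_top ENNReal.coe_lt_top) fun ε hε => ?_
  obtain ⟨L, hL, hc⟩ := hD ε hε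
  obtain ⟨M, hM, hc'⟩ := hc.map hlam hf
  exact ⟨M, hM.trans (by gcongr), hc'⟩

/-- If `f` is a contraction fixing `p` and `x`, `f x` are joined by chains of bounded length, then
so are `x` and `p`: concatenate the iterated images of the chains. -/
theorem chainDist_fixedPoint_lt_top {X : Type*} [MetricSpace X] {A : Set X} {f : X → X}
    {lam : ℝ≥0} (hlam : lam < 1) (hf : LipschitzWith lam f) {p x : X} (hp : f p = p)
    (h : chainDist A x (f x) < ⊤) : chainDist Set.univ x p < ⊤ := by
  obtain ⟨D, hD⟩ := exists_hasChain_of_chainDist_lt_top h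
  have horbit : ∀ ε > 0, ∀ n : ℕ, ∃ L ≤ (lam : ℝ≥0∞) ^ n * D,
      HasChain ε L (f^[n] x) (f^[n + 1] x) := by
    intro ε hε n
    induction n with
    | zero => simpa using hD ε hε
    | succ n ih =>
      obtain ⟨L, hL, hc⟩ := ih
      obtain ⟨M, hM, hc'⟩ := hc.map hlam.le hf
      refine ⟨M, hM.trans ?_, ?_⟩
      · rw [pow_succ', mul_assoc]
        gcongr
      · rwa [Function.iterate_succ_apply', Function.iterate_succ_apply' f (n + 1)]
  have hsum : ∀ ε > 0, ∀ n : ℕ, ∃ L ≤ ∑ i ∈ Finset.range n, (lam : ℝ≥0∞) ^ i * D,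
      HasChain ε L x (f^[n] x) := by
    intro ε hε n
    induction n with
    | zero => exact ⟨0, by simp, HasChain.refl x⟩
    | succ n ih =>
      obtain ⟨L, hL, hc⟩ := ih
      obtain ⟨M, hM, hc'⟩ := horbit ε hε n
      refine ⟨L + M, ?_, hc.trans hc'⟩
      rw [Finset.sum_range_succ]
      gcongr
  have hlim : Filter.Tendsto (fun n : ℕ => (lam : ℝ) ^ n * dist x p) Filter.atTop (nhds 0) := by
    simpa using (tendsto_pow_atTop_nhds_zero_of_lt_one lam.coe_nonneg
      (by exact_mod_cast hlam)).mul_const (dist x p)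
  refine chainDist_lt_top_of_hasChain (D := (1 - (lam : ℝ≥0∞))⁻¹ * D + 1) ?_ fun ε hε => ?_
  · refine ENNReal.add_lt_top.2 ⟨ENNReal.mul_lt_top ?_ ENNReal.coe_lt_top, ENNReal.one_lt_top⟩
    rw [ENNReal.inv_lt_top, tsub_pos_iff_lt]
    exact_mod_cast hlam
  · obtain ⟨n, hn⟩ := (hlim.eventually_lt_const (lt_min hε one_pos)).exists
    have hdist : dist (f^[n] x) p < min ε 1 := by
      have := (hf.iterate n).dist_le_mul x p
      rw [Function.iterate_fixed hp n, NNReal.coe_pow] at this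
      exact this.trans_lt hn
    obtain ⟨L, hL, hc⟩ := hsum ε hε n
    refine ⟨_, add_le_add (hL.trans ?_) ?_,
      hc.trans (HasChain.single (hdist.trans_le (min_le_left _ _)))⟩
    · rw [← Finset.sum_mul, ← ENNReal.tsum_geometric]
      gcongr
      exact ENNReal.sum_le_tsum _
    · rw [← ENNReal.ofReal_one]
      exact ENNReal.ofReal_le_ofReal (hdist.le.trans (min_le_right _ _))

/-- Let `K` be a compact metric space and `p ∈ K` be such that
`d̃(x,y,K) < ∞` for all `x, y ≠ p` and `d̃(x,p,K) = ∞` for all `x ≠ p`. If `f : K → K` is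
Lipschitz with constant `λ < 1` and `p` is in the range of `f`, then `f` is constantly `p`. -/
theorem range_eq_singleton_of_lipschitz {K : Type*} [MetricSpace K] [CompactSpace K] (p : K)
    (hfin : ∀ x y : K, x ≠ p → y ≠ p → chainDist (Set.univ : Set K) x y < ⊤)
    (hinf : ∀ x : K, x ≠ p → chainDist (Set.univ : Set K) x p = ⊤)
    (f : K → K) (lam : ℝ≥0) (hlam : lam < 1) (hf : LipschitzWith lam f)
    (hp : p ∈ Set.range f) :
    Set.range f = {p} := by
  have hmaps : ∀ x, x ≠ p → f x = p := by
    intro x hx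
    by_contra hfx
    obtain ⟨q, hq⟩ := hp
    rcases eq_or_ne q p with rfl | hqp
    · exact (chainDist_fixedPoint_lt_top hlam hf hq (hfin x (f x) hx hfx)).ne (hinf x hx)
    · have := chainDist_map_lt_top hlam.le hf (hfin x q hx hqp)
      rw [hq] at this
      exact this.ne (hinf (f x) hfx)
  have hfp : f p = p := by
    by_contra hne
    have hle := hf.dist_le_mul (f p) p
    rw [hmaps _ hne, dist_comm p] at hle
    have hpos : 0 < dist (f p) p := dist_pos.2 hne
    have hlt : (lam : ℝ) < 1 := by exact_mod_cast hlam
    nlinarith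
  refine Set.eq_singleton_iff_unique_mem.2 ⟨hp, ?_⟩
  rintro _ ⟨x, rfl⟩
  rcases eq_or_ne x p with rfl | hx
  · exact hfp
  · exact hmaps x hx
end

section
/- Let n ≥ 1 and let A ⊆ ℝⁿ be a continuum (nonempty compact connected set) such that any two points of A can be joined by a path in A of finite length (finite total variation). Fix a ∈ A and let C = (A × {0}) ∪ ({a} × [0,1]) ⊆ ℝⁿ × ℝ = ℝ^{n+1}. Then there exists a topological embedding h : C → ℝ^{n+1} such that h(C) is not the attractor of any iterated function system on ℝ^{n+1}, i.e., there is no finite family f₁, …, f_m : ℝ^{n+1} → ℝ^{n+1} of contractions with h(C) = f₁(h(C)) ∪ ⋯ ∪ f_m(h(C)). -/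
open scoped NNReal ENNReal

/-- `FineChain H x y V` says that `x` and `y` can be joined inside `H` by finite chains with
arbitrarily small steps and total length at most `V`. -/
def FineChain {E : Type*} [PseudoMetricSpace E] (H : Set E) (x y : E) (V : ℝ) : Prop :=
  ∀ δ > 0, ∃ (N : ℕ) (c : ℕ → E), c 0 = x ∧ c N = y ∧ (∀ i ≤ N, c i ∈ H) ∧
    (∀ i < N, dist (c i) (c (i + 1)) < δ) ∧ ∑ i ∈ Finset.range N, dist (c i) (c (i + 1)) ≤ V

/-- The logarithmic proximity of `x` to `p`, truncated to take values in `[0, τ]`. -/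
noncomputable def logDepth {E : Type*} [PseudoMetricSpace E] (p : E) (τ : ℝ) (x : E) : ℝ :=
  -Real.log (max (Real.exp (-τ)) (min 1 (dist x p)))

theorem FineChain.map {E : Type*} [PseudoMetricSpace E] {H : Set E} {x y : E} {V : ℝ}
    (h : FineChain H x y V) {K : ℝ≥0} (hK : K ≤ 1) {f : E → E} (hf : LipschitzWith K f)
    (hfH : Set.MapsTo f H H) : FineChain H (f x) (f y) (K * V) := by
  intro δ hδ
  obtain ⟨N, c, rfl, rfl, hcH, hstep, hsum⟩ := h δ hδ
  refine ⟨N, f ∘ c, rfl, rfl, fun i hi => hfH (hcH i hi), fun i hi => ?_, ?_⟩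
  · refine lt_of_le_of_lt (hf.dist_le_mul _ _) (lt_of_le_of_lt ?_ (hstep i hi))
    exact mul_le_of_le_one_left dist_nonneg (by exact_mod_cast hK)
  · calc ∑ i ∈ Finset.range N, dist ((f ∘ c) i) ((f ∘ c) (i + 1))
        ≤ ∑ i ∈ Finset.range N, K * dist (c i) (c (i + 1)) :=
          Finset.sum_le_sum fun i _ => hf.dist_le_mul _ _
      _ = K * ∑ i ∈ Finset.range N, dist (c i) (c (i + 1)) := by rw [Finset.mul_sum]
      _ ≤ K * V := by gcongr

theorem FineChain.abs_sub_le {E : Type*} [PseudoMetricSpace E] {H : Set E} {x y : E} {V : ℝ}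
    (h : FineChain H x y V) {K : ℝ} (hK : 0 ≤ K) {Ψ : E → ℝ}
    (hΨ : ∃ δ > 0, ∀ x ∈ H, ∀ y ∈ H, dist x y < δ → |Ψ x - Ψ y| ≤ K * dist x y) :
    |Ψ x - Ψ y| ≤ K * V := by
  obtain ⟨δ, hδ, hΨ⟩ := hΨ
  obtain ⟨N, c, rfl, rfl, hcH, hstep, hsum⟩ := h δ hδ
  calc |Ψ (c 0) - Ψ (c N)| = dist ((Ψ ∘ c) 0) ((Ψ ∘ c) N) := rfl
    _ ≤ ∑ i ∈ Finset.range N, dist ((Ψ ∘ c) i) ((Ψ ∘ c) (i + 1)) := dist_le_range_sum_dist _ _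
    _ ≤ ∑ i ∈ Finset.range N, K * dist (c i) (c (i + 1)) := by
        refine Finset.sum_le_sum fun i hi => ?_
        have hi := Finset.mem_range.1 hi
        exact hΨ _ (hcH i hi.le) _ (hcH _ hi) (hstep i hi)
    _ = K * ∑ i ∈ Finset.range N, dist (c i) (c (i + 1)) := by rw [Finset.mul_sum]
    _ ≤ K * V := by gcongr

theorem logDepth_of_dist_le {E : Type*} [PseudoMetricSpace E] {p x : E} {τ : ℝ}
    (h : dist x p ≤ Real.exp (-τ)) : logDepth p τ x = τ := by
  rw [logDepth, max_eq_left ((min_le_right _ _).trans h), Real.log_exp, neg_neg]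

theorem logDepth_le {E : Type*} [MetricSpace E] {p x : E} (h : x ≠ p) (τ : ℝ) :
    logDepth p τ x ≤ -Real.log (min 1 (dist x p)) := by
  have : 0 < min 1 (dist x p) := lt_min one_pos (dist_pos.2 h)
  exact neg_le_neg (Real.log_le_log this (le_max_right _ _))

theorem eq_of_abs_logDepth_sub_le {E : Type*} [MetricSpace E] {p x : E} {B : ℝ}
    (h : ∀ τ ≥ 0, |logDepth p τ x - logDepth p τ p| ≤ B) : x = p := by
  by_contra hne
  set M := -Real.log (min 1 (dist x p))
  have h₁ := h (|M| + |B| + 1) (by positivity)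
  have h₂ := logDepth_le hne (|M| + |B| + 1)
  rw [logDepth_of_dist_le (x := p) (by rw [dist_self]; positivity)] at h₁
  linarith [(abs_le.1 h₁).1, le_abs_self B, le_abs_self M]

theorem not_attractor_of_logDepth {E : Type*} [MetricSpace E] {H : Set E} (hH : IsCompact H)
    {p : E} {K K' : ℝ} (hK : 0 ≤ K)
    (hloc : ∀ τ ≥ 0, ∃ δ > 0, ∀ x ∈ H, ∀ y ∈ H, dist x y < δ →
      |logDepth p τ x - logDepth p τ y| ≤ K * dist x y)
    {γ : ℝ → E} (hγH : ∀ τ ≥ 0, γ τ ∈ H) (hγp : ∀ τ ≥ 0, dist (γ τ) p = Real.exp (-τ))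
    (hγc : ∀ τ ≥ 0, FineChain H (γ 0) (γ τ) (K' * τ))
    (hchain : ∀ x ∈ H, x ≠ p → ∃ V, FineChain H (γ 0) x V)
    {ι : Type*} [Finite ι] (f : ι → E → E)
    (hf : ∀ i, ∃ lam : ℝ≥0, lam < 1 ∧ LipschitzWith lam (f i)) : H ≠ ⋃ i, f i '' H := by
  intro hatt
  have hmaps : ∀ i, Set.MapsTo (f i) H H := fun i x hx => by
    rw [hatt]; exact Set.mem_iUnion.2 ⟨i, Set.mem_image_of_mem _ hx⟩
  have hγne : ∀ τ ≥ 0, γ τ ≠ p := fun τ hτ => dist_pos.1 (by rw [hγp τ hτ]; positivity)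
  have hex : ∀ k : ℕ, ∃ i, γ k ∈ f i '' H := fun k => by
    have := hγH k k.cast_nonneg
    rw [hatt] at this
    exact Set.mem_iUnion.1 this
  choose idx hidx using hex
  obtain ⟨i, hi⟩ := Finite.exists_infinite_fiber idx
  have hinf : (idx ⁻¹' {i}).Infinite := Set.infinite_coe_iff.1 hi
  obtain ⟨lam, hlam, hlip⟩ := hf i
  have hlim : Filter.Tendsto (fun k : ℕ => γ k) Filter.atTop (nhds p) := by
    rw [tendsto_iff_dist_tendsto_zero]
    have : (fun k : ℕ => dist (γ k) p) = fun k : ℕ => Real.exp (-(k : ℝ)) :=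
      funext fun k => hγp k k.cast_nonneg
    rw [this]
    exact Real.tendsto_exp_neg_atTop_nhds_zero.comp tendsto_natCast_atTop_atTop
  have hpi : p ∈ f i '' H := by
    refine (hH.image hlip.continuous).isClosed.mem_of_frequently_of_tendsto ?_ hlim
    refine (Nat.frequently_atTop_iff_infinite.2 hinf).mono fun k hk => ?_
    have hk : idx k = i := hk
    exact hk ▸ hidx k
  have hγinj : Function.Injective fun k : ℕ => γ k := fun k l hkl => by
    have h₁ := hγp k k.cast_nonneg
    have h₂ := hγp l l.cast_nonneg
    simp only at hkl
    rw [hkl, h₂, Real.exp_eq_exp] at h₁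
    exact_mod_cast (neg_inj.1 h₁).symm
  have hne : ∀ q ∈ H, q ≠ p → f i q ≠ p := by
    intro q hq hqp hfq
    obtain ⟨V, hV⟩ := hchain q hq hqp
    have hb : f i (γ 0) = p := by
      refine eq_of_abs_logDepth_sub_le (B := K * (lam * V)) fun τ hτ => ?_
      have := (hV.map hlam.le hlip (hmaps i)).abs_sub_le hK (hloc τ hτ)
      rwa [hfq] at this
    have hconst : f i '' H ⊆ {p, f i p} := by
      rintro _ ⟨y, hy, rfl⟩
      by_cases hyp : y = p
      · simp [hyp]
      obtain ⟨W, hW⟩ := hchain y hy hyp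
      left
      refine eq_of_abs_logDepth_sub_le (B := K * (lam * W)) fun τ hτ => ?_
      have := (hW.map hlam.le hlip (hmaps i)).abs_sub_le hK (hloc τ hτ)
      rwa [hb, abs_sub_comm] at this
    refine (hinf.image hγinj.injOn) ((Set.toFinite {p, f i p}).subset ?_)
    rintro _ ⟨k, hk, rfl⟩
    have hk : idx k = i := hk
    exact hconst (hk ▸ hidx k)
  have hfp : f i p = p := by
    obtain ⟨q, hq, hqp⟩ := hpi
    by_cases h : q = p
    · rwa [h] at hqp
    · exact absurd hqp (hne q hq h)
  obtain ⟨k, hk⟩ : ∃ k : ℕ, (lam : ℝ) ^ k * (K * |K'|) < 1 / 2 := by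
    have := (tendsto_pow_atTop_nhds_zero_of_lt_one lam.2
      (by exact_mod_cast hlam : (lam : ℝ) < 1)).mul_const (K * |K'|)
    rw [zero_mul] at this
    exact (this.eventually (gt_mem_nhds (by norm_num : (0 : ℝ) < 1 / 2))).exists
  have hlipk : LipschitzWith (lam ^ k) (f i)^[k] := hlip.iterate k
  have hlek : lam ^ k ≤ 1 := pow_le_one₀ lam.2 hlam.le
  have hbne : (f i)^[k] (γ 0) ≠ p := by
    have : ∀ j, (f i)^[j] (γ 0) ∈ H ∧ (f i)^[j] (γ 0) ≠ p := by
      intro j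
      induction j with
      | zero => exact ⟨hγH 0 le_rfl, hγne 0 le_rfl⟩
      | succ j ih =>
        rw [Function.iterate_succ_apply']
        exact ⟨hmaps i ih.1, hne _ ih.1 ih.2⟩
    exact (this k).2
  set M := -Real.log (min 1 (dist ((f i)^[k] (γ 0)) p))
  set τ := 2 * |M| + 1 with hτ
  have hτ0 : 0 ≤ τ := by positivity
  have h₁ := ((hγc τ hτ0).map hlek hlipk ((hmaps i).iterate k)).abs_sub_le hK (hloc τ hτ0)
  have h₂ : logDepth p τ ((f i)^[k] (γ τ)) = τ := by
    refine logDepth_of_dist_le ?_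
    have h := hlipk.dist_le_mul (γ τ) p
    rw [Function.iterate_fixed hfp, hγp τ hτ0] at h
    exact h.trans (mul_le_of_le_one_left (Real.exp_nonneg _) (by exact_mod_cast hlek))
  have h₃ := logDepth_le hbne τ
  rw [h₂] at h₁
  have h₄ : K * (((lam ^ k : ℝ≥0) : ℝ) * (K' * τ)) ≤ 1 / 2 * τ := by
    push_cast
    calc K * ((lam : ℝ) ^ k * (K' * τ)) = ((lam : ℝ) ^ k * (K * K')) * τ := by ring
      _ ≤ ((lam : ℝ) ^ k * (K * |K'|)) * τ := by gcongr; exact le_abs_self _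
      _ ≤ 1 / 2 * τ := by gcongr
  linarith [(abs_le.1 h₁).1, le_abs_self M, abs_nonneg M]

theorem FineChain.of_continuousOn {E : Type*} [PseudoMetricSpace E] {H : Set E} {g : ℝ → E}
    {T V : ℝ} (hT : 0 ≤ T) (hg : ContinuousOn g (Set.Icc 0 T))
    (hgH : Set.MapsTo g (Set.Icc 0 T) H)
    (hV : ∀ u : ℕ → ℝ, Monotone u → ∀ N, u 0 = 0 → u N = T →
      ∑ i ∈ Finset.range N, dist (g (min (u i) T)) (g (min (u (i + 1)) T)) ≤ V) :
    FineChain H (g 0) (g T) V := by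
  intro δ hδ
  obtain ⟨η, hη, hgη⟩ := Metric.uniformContinuousOn_iff.1
    (isCompact_Icc.uniformContinuousOn_of_continuous hg) δ hδ
  obtain ⟨N, hN⟩ := exists_nat_gt (T / η)
  have hN0 : (0 : ℝ) < N := (div_nonneg hT hη.le).trans_lt hN
  set u : ℕ → ℝ := fun i => T * i / N with hu
  have hu0 : u 0 = 0 := by simp [hu]
  have huN : u N = T := by simp only [hu]; field_simp
  have hmono : Monotone u := fun i j hij => by
    simp only [hu]; gcongr
  have hmem : ∀ i, min (u i) T ∈ Set.Icc 0 T := fun i =>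
    ⟨le_min (hu0 ▸ hmono (Nat.zero_le i)) hT, min_le_right _ _⟩
  refine ⟨N, fun i => g (min (u i) T), by simp [hu0, hT], by simp [huN],
    fun i _ => hgH (hmem i), fun i _ => hgη _ (hmem i) _ (hmem _) ?_, hV u hmono N hu0 huN⟩
  rw [Real.dist_eq]
  calc |min (u i) T - min (u (i + 1)) T| ≤ |u i - u (i + 1)| := by
        have := abs_min_sub_min_le_max (u i) T (u (i + 1)) T
        simpa using this
    _ = T / N := by
        rw [abs_sub_comm, abs_of_nonneg (sub_nonneg.2 (hmono i.le_succ))]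
        simp only [hu]; push_cast; field_simp; ring
    _ < η := by rw [div_lt_iff₀ hN0]; rwa [div_lt_iff₀ hη, mul_comm] at hN

theorem FineChain.of_eVariationOn {E : Type*} [PseudoMetricSpace E] {H : Set E} {g : ℝ → E}
    {T : ℝ} (hT : 0 ≤ T) (hg : ContinuousOn g (Set.Icc 0 T))
    (hgH : Set.MapsTo g (Set.Icc 0 T) H) (hfin : eVariationOn g (Set.Icc 0 T) ≠ ⊤) :
    FineChain H (g 0) (g T) (eVariationOn g (Set.Icc 0 T)).toReal := by
  refine .of_continuousOn hT hg hgH fun u hu N hu0 huN => ?_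
  have hmem : ∀ i, min (u i) T ∈ Set.Icc 0 T := fun i =>
    ⟨le_min (hu0 ▸ hu (Nat.zero_le i)) hT, min_le_right _ _⟩
  have h := eVariationOn.sum_le (f := g) (n := N) (u := fun i => min (u i) T)
    (fun i j hij => min_le_min_right T (hu hij)) hmem
  refine le_trans (le_of_eq ?_) (ENNReal.toReal_mono hfin h)
  rw [ENNReal.toReal_sum fun i _ => edist_ne_top _ _]
  exact Finset.sum_congr rfl fun i _ => by rw [dist_comm, dist_edist]

theorem FineChain.of_lipschitzOnWith {E : Type*} [PseudoMetricSpace E] {H : Set E} {g : ℝ → E}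
    {T : ℝ} (hT : 0 ≤ T) {K : ℝ≥0} (hg : LipschitzOnWith K g (Set.Icc 0 T))
    (hgH : Set.MapsTo g (Set.Icc 0 T) H) : FineChain H (g 0) (g T) (K * T) := by
  refine .of_continuousOn hT hg.continuousOn hgH fun u hu N hu0 huN => ?_
  have hmem : ∀ i, min (u i) T ∈ Set.Icc 0 T := fun i =>
    ⟨le_min (hu0 ▸ hu (Nat.zero_le i)) hT, min_le_right _ _⟩
  calc _ ≤ ∑ i ∈ Finset.range N, K * (min (u (i + 1)) T - min (u i) T) := by
        refine Finset.sum_le_sum fun i _ => ?_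
        have h := hg.dist_le_mul _ (hmem i) _ (hmem (i + 1))
        rwa [Real.dist_eq, abs_sub_comm,
          abs_of_nonneg (sub_nonneg.2 (min_le_min_right T (hu i.le_succ)))] at h
    _ = K * T := by
        rw [← Finset.mul_sum, Finset.sum_range_sub fun i => min (u i) T]
        simp [hu0, huN, hT]

theorem abs_logDepth_sub_le {E : Type*} [MetricSpace E] {H : Set E} {p : E} {K : ℝ} (hK : 0 ≤ K)
    (hloc : ∀ η > 0, ∃ δ > 0, ∀ x ∈ H, ∀ y ∈ H, η ≤ dist x p → η ≤ dist y p → dist x y < δ →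
      |Real.log (min 1 (dist x p)) - Real.log (min 1 (dist y p))| ≤ K * dist x y) (τ : ℝ) :
    ∃ δ > 0, ∀ x ∈ H, ∀ y ∈ H, dist x y < δ →
      |logDepth p τ x - logDepth p τ y| ≤ K * dist x y := by
  set ε := Real.exp (-τ)
  have hε : 0 < ε := Real.exp_pos _
  obtain ⟨δ, hδ, hδH⟩ := hloc (ε / 2) (by positivity)
  refine ⟨min δ (ε / 2), lt_min hδ (by positivity), fun x hx y hy hxy => ?_⟩
  have hd : |dist x p - dist y p| ≤ dist x y := abs_dist_sub_le _ _ _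
  have hd' := abs_le.1 hd
  have h₁ := hxy.trans_le (min_le_left _ _)
  have h₂ := hxy.trans_le (min_le_right _ _)
  by_cases hsmall : dist x p ≤ ε ∧ dist y p ≤ ε
  · rw [logDepth_of_dist_le hsmall.1, logDepth_of_dist_le hsmall.2, sub_self, abs_zero]
    positivity
  have hxp : ε / 2 ≤ dist x p := by
    by_contra! h
    exact hsmall ⟨by linarith, by linarith⟩
  have hyp : ε / 2 ≤ dist y p := by
    by_contra! h
    exact hsmall ⟨by linarith, by linarith⟩
  have hmax : ∀ z, ε / 2 ≤ dist z p → logDepth p τ z = -max (Real.log ε)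
      (Real.log (min 1 (dist z p))) := fun z hz => by
    have h0 : 0 < min 1 (dist z p) := lt_min one_pos (by linarith)
    rw [logDepth]
    congr 1
    exact Real.strictMonoOn_log.monotoneOn.map_max hε h0
  rw [hmax x hxp, hmax y hyp, neg_sub_neg, abs_sub_comm, max_comm, max_comm (Real.log ε)]
  exact (abs_max_sub_max_le_abs _ _ _).trans (hδH x hx y hy hxp hyp h₁)

theorem abs_log_sub_log_le_of_sq {ρ ρ' η d : ℝ} (hη : 0 < η) (hη1 : η ≤ 1) (hρ : η ≤ ρ)
    (hρ' : η ≤ ρ') (hd0 : 0 ≤ d) (hdη : d < η ^ 2)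
    (hd : d ^ 2 = (ρ - ρ') ^ 2 + 2 * (ρ * ρ') * (1 - Real.cos (ρ⁻¹ - ρ'⁻¹))) :
    |Real.log ρ - Real.log ρ'| ≤ 4 * d := by
  wlog hle : ρ ≤ ρ' generalizing ρ ρ'
  · rw [abs_sub_comm]
    refine this hρ' hρ ?_ (le_of_not_ge hle)
    rw [hd, ← Real.cos_neg, neg_sub]
    ring
  have hρ0 : 0 < ρ := hη.trans_le hρ
  have hρ0' : 0 < ρ' := hη.trans_le hρ'
  have hcos := Real.cos_le_one (ρ⁻¹ - ρ'⁻¹)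
  have hΔ : ρ' - ρ ≤ d := by
    refine (le_abs_self _).trans (abs_le_of_sq_le_sq ?_ hd0)
    rw [hd]
    nlinarith [mul_nonneg (mul_pos hρ0 hρ0').le (sub_nonneg.2 hcos)]
  have hang : ρ⁻¹ - ρ'⁻¹ = (ρ' - ρ) / (ρ * ρ') := by field_simp
  have hang0 : 0 ≤ ρ⁻¹ - ρ'⁻¹ := by
    rw [hang]; exact div_nonneg (sub_nonneg.2 hle) (by positivity)
  have hηρ : η ^ 2 ≤ ρ * ρ' := by rw [sq]; gcongr
  have hang1 : ρ⁻¹ - ρ'⁻¹ ≤ 1 := by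
    rw [hang, div_le_one (by positivity)]; linarith
  have hquad := Real.cos_le_one_sub_mul_cos_sq
    (x := ρ⁻¹ - ρ'⁻¹) (by rw [abs_of_nonneg hang0]; linarith [Real.pi_gt_three])
  have hpi : 1 / 8 ≤ 2 / Real.pi ^ 2 := by
    rw [div_le_div_iff₀ (by norm_num) (by positivity)]
    nlinarith [Real.pi_le_four, Real.pi_pos]
  have h2 : ρ' ≤ 2 * ρ := by nlinarith
  have hlog : Real.log ρ' - Real.log ρ ≤ (ρ' - ρ) / ρ := by
    rw [← Real.log_div hρ0'.ne' hρ0.ne', sub_div, div_self hρ0.ne']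
    exact Real.log_le_sub_one_of_pos (by positivity)
  rw [abs_sub_comm, abs_of_nonneg (sub_nonneg.2 (Real.log_le_log hρ0 hle))]
  refine hlog.trans ((le_abs_self _).trans (abs_le_of_sq_le_sq ?_ (by positivity)))
  have hkey : (ρ' - ρ) ^ 2 / (4 * (ρ * ρ')) ≤ d ^ 2 := by
    rw [hd]
    have h1 : (1 / 8) * (ρ⁻¹ - ρ'⁻¹) ^ 2 ≤ 1 - Real.cos (ρ⁻¹ - ρ'⁻¹) := by
      nlinarith [sq_nonneg (ρ⁻¹ - ρ'⁻¹)]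
    have h3 : (ρ' - ρ) ^ 2 / (4 * (ρ * ρ')) = 2 * (ρ * ρ') * ((1 / 8) * (ρ⁻¹ - ρ'⁻¹) ^ 2) := by
      rw [hang]; field_simp; ring
    rw [h3]
    have := mul_le_mul_of_nonneg_left h1 (by positivity : 0 ≤ 2 * (ρ * ρ'))
    nlinarith [sq_nonneg (ρ - ρ')]
  calc ((ρ' - ρ) / ρ) ^ 2 = 8 * ((ρ' - ρ) ^ 2 / (4 * (ρ * (2 * ρ)))) := by
        field_simp
        ring
    _ ≤ 8 * ((ρ' - ρ) ^ 2 / (4 * (ρ * ρ'))) := by gcongr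
    _ ≤ (4 * d) ^ 2 := by nlinarith [sq_nonneg d]

theorem dist_toLp_sq {V : Type*} [SeminormedAddCommGroup V] (x y : V) (s t : ℝ) :
    dist (WithLp.toLp 2 (x, s)) (WithLp.toLp 2 (y, t)) ^ 2 = ‖x - y‖ ^ 2 + (s - t) ^ 2 := by
  rw [dist_eq_norm, WithLp.prod_norm_sq_eq_of_L2]
  simp

theorem abs_snd_sub_le_dist {V : Type*} [SeminormedAddCommGroup V]
    (p q : WithLp 2 (V × ℝ)) : |p.snd - q.snd| ≤ dist p q := by
  refine abs_le_of_sq_le_sq ?_ dist_nonneg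
  rw [dist_eq_norm, WithLp.prod_norm_sq_eq_of_L2]
  simp

/-- The point at distance `ρ` from `(x, 1)` on a spiral that lies in the plane through `(x, 1)`
spanned by `e` and the vertical direction, winds towards `(x, 1)` as `ρ → 0`, and passes through
`(x, 0)` at `ρ = 1`. -/
noncomputable def coil {V : Type*} [NormedAddCommGroup V] [NormedSpace ℝ V] (e x : V) (ρ : ℝ) :
    WithLp 2 (V × ℝ) :=
  WithLp.toLp 2 (x + (ρ * Real.sin (ρ⁻¹ - 1)) • e, 1 - ρ * Real.cos (ρ⁻¹ - 1))

/-- The set `A × {0}` together with the arc of the spiral `coil e a` from `(a, 0)` to `(a, 1)`. -/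
def coiledWedge {V : Type*} [NormedAddCommGroup V] [NormedSpace ℝ V] (e : V) (A : Set V) (a : V) :
    Set (WithLp 2 (V × ℝ)) :=
  (fun x => coil e x 1) '' A ∪ coil e a '' Set.Icc 0 1

section Coil

variable {V : Type*} [NormedAddCommGroup V] [NormedSpace ℝ V] {e : V}

theorem coil_one (e x : V) : coil e x 1 = WithLp.toLp 2 (x, 0) := by
  simp [coil]

theorem dist_coil_sq (he : ‖e‖ = 1) (x : V) (ρ ρ' : ℝ) : dist (coil e x ρ) (coil e x ρ') ^ 2 =
    (ρ - ρ') ^ 2 + 2 * (ρ * ρ') * (1 - Real.cos (ρ⁻¹ - ρ'⁻¹)) := by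
  rw [coil, coil, dist_toLp_sq, add_sub_add_left_eq_sub, ← sub_smul, norm_smul, he, mul_one,
    Real.norm_eq_abs, sq_abs]
  have hcos := Real.cos_sub (ρ⁻¹ - 1) (ρ'⁻¹ - 1)
  rw [sub_sub_sub_cancel_right] at hcos
  rw [hcos]
  linear_combination ρ ^ 2 * Real.sin_sq_add_cos_sq (ρ⁻¹ - 1)
    + ρ' ^ 2 * Real.sin_sq_add_cos_sq (ρ'⁻¹ - 1)

theorem dist_coil_apex (he : ‖e‖ = 1) (x : V) {ρ : ℝ} (hρ : 0 ≤ ρ) :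
    dist (coil e x ρ) (WithLp.toLp 2 (x, 1)) = ρ := by
  have h := dist_coil_sq he x ρ 0
  have h0 : coil e x 0 = WithLp.toLp 2 (x, 1) := by simp [coil]
  rw [h0] at h
  simp only [sub_zero, mul_zero, zero_mul, add_zero] at h
  exact (sq_eq_sq₀ dist_nonneg hρ).1 h

theorem le_dist_base_coil (e x y : V) {ρ : ℝ} (hρ : 0 ≤ ρ) :
    1 - ρ ≤ dist (coil e y 1) (coil e x ρ) := by
  have h := (abs_le.1 (abs_snd_sub_le_dist (coil e y 1) (coil e x ρ))).1
  have hy : (coil e y 1).snd = 0 := by simp [coil]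
  have hx : (coil e x ρ).snd = 1 - ρ * Real.cos (ρ⁻¹ - 1) := rfl
  rw [hx, hy] at h
  nlinarith [Real.cos_le_one (ρ⁻¹ - 1)]

theorem one_le_dist_base_apex (e x y : V) :
    1 ≤ dist (coil e y 1) (WithLp.toLp 2 (x, 1)) := by
  have h := le_dist_base_coil e x y le_rfl
  simpa [coil] using h

theorem abs_log_le_dist_base_coil (e x y : V) {ρ : ℝ} (hρ : 0 < ρ) (hρ1 : ρ ≤ 1)
    (hd : dist (coil e y 1) (coil e x ρ) < 1 / 4) :
    |Real.log ρ| ≤ 4 * dist (coil e y 1) (coil e x ρ) := by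
  have h := le_dist_base_coil e x y hρ.le
  rw [abs_of_nonpos (Real.log_nonpos hρ.le hρ1), ← Real.log_inv]
  have h2 : ρ⁻¹ - 1 ≤ 4 * (1 - ρ) := by
    rw [show ρ⁻¹ - 1 = (1 - ρ) / ρ by field_simp, div_le_iff₀ hρ]
    nlinarith
  linarith [Real.log_le_sub_one_of_pos (inv_pos.2 hρ)]

theorem coiledWedge_log_local (he : ‖e‖ = 1) (A : Set V) (a : V) {η : ℝ} (hη : 0 < η) :
    ∃ δ > 0, ∀ x ∈ coiledWedge e A a, ∀ y ∈ coiledWedge e A a,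
      η ≤ dist x (WithLp.toLp 2 (a, 1)) → η ≤ dist y (WithLp.toLp 2 (a, 1)) → dist x y < δ →
      |Real.log (min 1 (dist x (WithLp.toLp 2 (a, 1)))) -
        Real.log (min 1 (dist y (WithLp.toLp 2 (a, 1))))| ≤ 4 * dist x y := by
  have hm : 0 < min η (1 / 2) := lt_min hη (by norm_num)
  have hm2 : min η (1 / 2) ≤ 1 / 2 := min_le_right _ _
  have hm4 : min η (1 / 2) ^ 2 ≤ 1 / 4 := by nlinarith
  refine ⟨min η (1 / 2) ^ 2, by positivity, ?_⟩
  rintro _ (⟨x, hx, rfl⟩ | ⟨ρ, hρ, rfl⟩) _ (⟨y, hy, rfl⟩ | ⟨ρ', hρ', rfl⟩) hηx hηy hd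
  · simp only [min_eq_left (one_le_dist_base_apex e a _), sub_self, abs_zero]
    positivity
  · rw [dist_coil_apex he a hρ'.1] at hηy
    rw [min_eq_left (one_le_dist_base_apex e a _), dist_coil_apex he a hρ'.1,
      min_eq_right hρ'.2, Real.log_one, zero_sub, abs_neg]
    exact abs_log_le_dist_base_coil e a x (hη.trans_le hηy) hρ'.2 (hd.trans_le hm4)
  · rw [dist_coil_apex he a hρ.1] at hηx
    rw [dist_comm] at hd
    rw [min_eq_left (one_le_dist_base_apex e a _), dist_coil_apex he a hρ.1,
      min_eq_right hρ.2, Real.log_one, sub_zero, dist_comm]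
    exact abs_log_le_dist_base_coil e a y (hη.trans_le hηx) hρ.2 (hd.trans_le hm4)
  · rw [dist_coil_apex he a hρ.1] at hηx ⊢
    rw [dist_coil_apex he a hρ'.1] at hηy ⊢
    rw [min_eq_right hρ.2, min_eq_right hρ'.2]
    exact abs_log_sub_log_le_of_sq hm (by linarith) ((min_le_left _ _).trans hηx)
      ((min_le_left _ _).trans hηy) dist_nonneg hd (dist_coil_sq he a ρ ρ')

theorem lipschitzOnWith_coil_exp (he : ‖e‖ = 1) (x : V) :
    LipschitzOnWith 4 (fun τ : ℝ => coil e x (Real.exp (-τ))) (Set.Ici 0) := by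
  have hexp : ∀ τ : ℝ, HasDerivAt (fun τ => Real.exp (-τ)) (-Real.exp (-τ)) τ := fun τ => by
    simpa using (hasDerivAt_neg τ).exp
  have hang : ∀ τ : ℝ, HasDerivAt (fun τ => Real.exp τ - 1) (Real.exp τ) τ := fun τ =>
    (Real.hasDerivAt_exp τ).sub_const 1
  have hle : ∀ τ ∈ Set.Ici (0 : ℝ), Real.exp (-τ) ≤ 1 := fun τ hτ =>
    Real.exp_le_one_iff.2 (neg_nonpos.2 hτ)
  have hmul : ∀ τ : ℝ, Real.exp (-τ) * Real.exp τ = 1 := fun τ => by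
    rw [← Real.exp_add, neg_add_cancel, Real.exp_zero]
  have hbound : ∀ r u v : ℝ, 0 ≤ r → r ≤ 1 → |u| ≤ 1 → |v| ≤ 1 → ‖-r * u + v‖ ≤ 2 := by
    intro r u v hr hr1 hu hv
    rw [Real.norm_eq_abs]
    refine (abs_add_le _ _).trans ?_
    rw [abs_mul, abs_neg, abs_of_nonneg hr]
    nlinarith [abs_nonneg u]
  have hsin : ∀ s ∈ Set.Ici (0 : ℝ), ∀ t ∈ Set.Ici (0 : ℝ),
      ‖Real.exp (-t) * Real.sin (Real.exp t - 1) - Real.exp (-s) * Real.sin (Real.exp s - 1)‖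
        ≤ 2 * ‖t - s‖ := by
    intro s hs t ht
    refine (convex_Ici (0 : ℝ)).norm_image_sub_le_of_norm_hasDerivWithin_le
      (f := fun τ => Real.exp (-τ) * Real.sin (Real.exp τ - 1))
      (fun τ _ => ((hexp τ).mul (hang τ).sin).hasDerivWithinAt) (fun τ hτ => ?_) hs ht
    rw [mul_left_comm, hmul, mul_one]
    exact hbound _ _ _ (Real.exp_nonneg _) (hle τ hτ) (Real.abs_sin_le_one _)
      (Real.abs_cos_le_one _)
  have hcos : ∀ s ∈ Set.Ici (0 : ℝ), ∀ t ∈ Set.Ici (0 : ℝ),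
      ‖Real.exp (-t) * Real.cos (Real.exp t - 1) - Real.exp (-s) * Real.cos (Real.exp s - 1)‖
        ≤ 2 * ‖t - s‖ := by
    intro s hs t ht
    refine (convex_Ici (0 : ℝ)).norm_image_sub_le_of_norm_hasDerivWithin_le
      (f := fun τ => Real.exp (-τ) * Real.cos (Real.exp τ - 1))
      (fun τ _ => ((hexp τ).mul (hang τ).cos).hasDerivWithinAt) (fun τ hτ => ?_) hs ht
    rw [mul_left_comm, hmul, mul_one]
    exact hbound _ _ _ (Real.exp_nonneg _) (hle τ hτ) (Real.abs_cos_le_one _)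
      (by rw [abs_neg]; exact Real.abs_sin_le_one _)
  refine LipschitzOnWith.of_dist_le_mul fun s hs t ht => ?_
  have h₁ := hsin t ht s hs
  have h₂ := hcos t ht s hs
  refine abs_le_of_sq_le_sq' ?_ (by positivity) |>.2
  rw [coil, coil, dist_toLp_sq, add_sub_add_left_eq_sub, ← sub_smul, norm_smul, he, mul_one,
    sub_sub_sub_cancel_left, Real.exp_neg s, Real.exp_neg t, inv_inv, inv_inv, ← Real.exp_neg,
    ← Real.exp_neg, Real.dist_eq, ← Real.norm_eq_abs]
  have h₃ := pow_le_pow_left₀ (norm_nonneg _) h₁ 2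
  have h₄ := pow_le_pow_left₀ (norm_nonneg _) h₂ 2
  simp only [Real.norm_eq_abs, mul_pow, sq_abs, NNReal.coe_ofNat] at h₃ h₄ ⊢
  nlinarith [sq_nonneg (s - t)]

theorem continuous_coil (e : V) : Continuous fun q : V × ℝ => coil e q.1 q.2 := by
  have hmul : ∀ g : ℝ → ℝ, Continuous g → (∀ t, |g t| ≤ 1) →
      Continuous fun ρ : ℝ => ρ * g (ρ⁻¹ - 1) := by
    intro g hg hg1
    refine continuous_iff_continuousAt.2 fun ρ => ?_
    rcases eq_or_ne ρ 0 with rfl | hρ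
    · rw [ContinuousAt, zero_mul]
      refine squeeze_zero_norm (a := fun ρ => |ρ|) (fun t => ?_)
        (by simpa using continuous_abs.tendsto (0 : ℝ))
      rw [Real.norm_eq_abs, abs_mul]
      exact mul_le_of_le_one_right (abs_nonneg t) (hg1 _)
    · exact continuousAt_id.mul
        (hg.continuousAt.comp ((continuousAt_inv₀ hρ).sub continuousAt_const))
  have hs := hmul Real.sin Real.continuous_sin Real.abs_sin_le_one
  have hc := hmul Real.cos Real.continuous_cos Real.abs_cos_le_one
  refine (WithLp.prod_continuous_toLp 2 V ℝ).comp ?_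
  exact (continuous_fst.add ((hs.comp continuous_snd).smul continuous_const)).prodMk
    (continuous_const.sub (hc.comp continuous_snd))

theorem lipschitzWith_coil_one (e : V) : LipschitzWith 1 fun x => coil e x 1 := by
  refine LipschitzWith.of_dist_le_mul fun x y => ?_
  refine (le_abs_self _).trans (abs_le_of_sq_le_sq ?_ (by positivity))
  rw [coil_one, coil_one, dist_toLp_sq, dist_eq_norm]
  simp

theorem isCompact_coiledWedge (e : V) {A : Set V} (hA : IsCompact A) (a : V) :
    IsCompact (coiledWedge e A a) :=
  (hA.image (lipschitzWith_coil_one e).continuous).union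
    (isCompact_Icc.image ((continuous_coil e).comp (.prodMk_right a)))

theorem coiledWedge_not_attractor (he : ‖e‖ = 1) {A : Set V} (hA : IsCompact A) {a : V}
    (hpath : ∀ y ∈ A, ∃ γ : ℝ → V, ContinuousOn γ (Set.Icc 0 1) ∧ γ 0 = a ∧ γ 1 = y ∧
      Set.MapsTo γ (Set.Icc 0 1) A ∧ eVariationOn γ (Set.Icc 0 1) < ⊤)
    {ι : Type*} [Finite ι] (f : ι → WithLp 2 (V × ℝ) → WithLp 2 (V × ℝ))
    (hf : ∀ i, ∃ lam : ℝ≥0, lam < 1 ∧ LipschitzWith lam (f i)) :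
    coiledWedge e A a ≠ ⋃ i, f i '' coiledWedge e A a := by
  have hmem : ∀ τ : ℝ, 0 ≤ τ → Real.exp (-τ) ∈ Set.Icc (0 : ℝ) 1 := fun τ hτ =>
    ⟨Real.exp_nonneg _, Real.exp_le_one_iff.2 (neg_nonpos.2 hτ)⟩
  have hcoil : ∀ τ ≥ 0, FineChain (coiledWedge e A a) (coil e a (Real.exp (-0)))
      (coil e a (Real.exp (-τ))) ((4 : ℝ≥0) * τ) := fun τ hτ =>
    FineChain.of_lipschitzOnWith (g := fun τ => coil e a (Real.exp (-τ))) hτ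
      ((lipschitzOnWith_coil_exp he a).mono Set.Icc_subset_Ici_self)
      fun t ht => .inr ⟨_, hmem t ht.1, rfl⟩
  refine not_attractor_of_logDepth (p := WithLp.toLp 2 (a, 1)) (K := 4)
    (γ := fun τ => coil e a (Real.exp (-τ))) (isCompact_coiledWedge e hA a) (by norm_num)
    (fun τ _ => abs_logDepth_sub_le (by norm_num)
      (fun η hη => coiledWedge_log_local he A a hη) τ)
    (fun τ hτ => .inr ⟨_, hmem τ hτ, rfl⟩) (fun τ _ => dist_coil_apex he a (Real.exp_nonneg _))
    hcoil ?_ f hf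
  rintro _ (⟨y, hy, rfl⟩ | ⟨ρ, hρ, rfl⟩) hne
  · obtain ⟨γ, hγ, rfl, rfl, hγA, hvar⟩ := hpath y hy
    have hlip := (lipschitzWith_coil_one e).lipschitzOnWith (s := Set.univ)
    have hvar' : eVariationOn ((fun x => coil e x 1) ∘ γ) (Set.Icc 0 1) ≠ ⊤ := by
      refine ne_top_of_le_ne_top ?_ (hlip.comp_eVariationOn_le (Set.mapsTo_univ γ _))
      exact ENNReal.mul_ne_top ENNReal.coe_ne_top hvar.ne
    have h := FineChain.of_eVariationOn (H := coiledWedge e A (γ 0)) zero_le_one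
      ((lipschitzWith_coil_one e).continuous.comp_continuousOn hγ)
      (fun t ht => .inl ⟨_, hγA ht, rfl⟩) hvar'
    simp only [neg_zero, Real.exp_zero]
    exact ⟨_, h⟩
  · have hρ0 : 0 < ρ := by
      refine hρ.1.lt_of_ne fun h => hne ?_
      rw [← dist_eq_zero, dist_coil_apex he a hρ.1, h]
    have h := hcoil (-Real.log ρ) (neg_nonneg.2 (Real.log_nonpos hρ.1 hρ.2))
    rw [neg_neg, Real.exp_log hρ0] at h
    exact ⟨_, h⟩

theorem coil_one_eq_coil_iff {x a : V} {ρ : ℝ} (hρ : ρ ∈ Set.Icc (0 : ℝ) 1) :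
    coil e x 1 = coil e a ρ ↔ x = a ∧ ρ = 1 := by
  refine ⟨fun h => ?_, fun ⟨hx, h⟩ => by rw [hx, h]⟩
  have h₁ := le_dist_base_coil e a x hρ.1
  rw [h, dist_self] at h₁
  obtain rfl : ρ = 1 := le_antisymm hρ.2 (by linarith)
  rw [coil_one, coil_one] at h
  simpa using h

theorem injOn_coil (he : ‖e‖ = 1) (a : V) : Set.InjOn (coil e a) (Set.Icc 0 1) := by
  intro ρ hρ ρ' hρ' h
  rw [← dist_coil_apex he a hρ.1, h, dist_coil_apex he a hρ'.1]

end Coil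

/-- Let `A ⊆ ℝⁿ` (`n ≥ 1`) be a continuum in which any two points can be
joined by a path in `A` of finite length, let `a ∈ A`, and let
`C = (A × {0}) ∪ ({a} × [0,1]) ⊆ ℝⁿ × ℝ = ℝ^{n+1}` (with the Euclidean, i.e. `ℓ²`, metric on
the product). Then there is a topological embedding `h` of `C` into `ℝ^{n+1}` (a continuous
injection on the compact set `C`) such that `h(C)` is not the attractor of any IFS. -/
theorem wedge_embedding_not_attractor (n : ℕ) (hn : 1 ≤ n)
    (A : Set (EuclideanSpace ℝ (Fin n))) (hAne : A.Nonempty) (hAcomp : IsCompact A)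
    (hAconn : IsConnected A)
    (hpath : ∀ x ∈ A, ∀ y ∈ A, ∃ γ : ℝ → EuclideanSpace ℝ (Fin n),
      ContinuousOn γ (Set.Icc 0 1) ∧ γ 0 = x ∧ γ 1 = y ∧
      Set.MapsTo γ (Set.Icc 0 1) A ∧ eVariationOn γ (Set.Icc 0 1) < ⊤)
    (a : EuclideanSpace ℝ (Fin n)) (ha : a ∈ A)
    (C : Set (WithLp 2 (EuclideanSpace ℝ (Fin n) × ℝ)))
    (hC : C = {q : WithLp 2 (EuclideanSpace ℝ (Fin n) × ℝ) |
      ((WithLp.equiv 2 _ q).1 ∈ A ∧ (WithLp.equiv 2 _ q).2 = 0) ∨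
      ((WithLp.equiv 2 _ q).1 = a ∧ (WithLp.equiv 2 _ q).2 ∈ Set.Icc (0 : ℝ) 1)}) :
    ∃ h : WithLp 2 (EuclideanSpace ℝ (Fin n) × ℝ) → WithLp 2 (EuclideanSpace ℝ (Fin n) × ℝ),
      ContinuousOn h C ∧ Set.InjOn h C ∧
      ¬ ∃ (m : ℕ)
          (f : Fin m → WithLp 2 (EuclideanSpace ℝ (Fin n) × ℝ) →
            WithLp 2 (EuclideanSpace ℝ (Fin n) × ℝ)),
          (∀ i, ∃ lam : ℝ≥0, lam < 1 ∧ LipschitzWith lam (f i)) ∧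
          h '' C = ⋃ i, f i '' (h '' C) := by
  have he : ‖(EuclideanSpace.single ⟨0, hn⟩ 1 : EuclideanSpace ℝ (Fin n))‖ = 1 := by simp
  set e : EuclideanSpace ℝ (Fin n) := EuclideanSpace.single ⟨0, hn⟩ 1
  have himage : (fun q : WithLp 2 (EuclideanSpace ℝ (Fin n) × ℝ) =>
      coil e q.fst (1 - q.snd)) '' C = coiledWedge e A a := by
    subst hC
    ext p
    constructor
    · rintro ⟨q, ⟨hqA, hq0⟩ | ⟨hqa, hq⟩, rfl⟩
      · exact .inl ⟨q.fst, hqA, by simp only [show q.snd = 0 from hq0, sub_zero]⟩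
      · exact .inr ⟨1 - q.snd, ⟨sub_nonneg.2 hq.2, sub_le_self _ hq.1⟩,
          by simp only [show q.fst = a from hqa]⟩
    · rintro (⟨x, hx, rfl⟩ | ⟨ρ, hρ, rfl⟩)
      · exact ⟨WithLp.toLp 2 (x, 0), .inl ⟨hx, rfl⟩, by simp⟩
      · exact ⟨WithLp.toLp 2 (a, 1 - ρ), .inr ⟨rfl, sub_nonneg.2 hρ.2, sub_le_self _ hρ.1⟩,
          by simp⟩
  refine ⟨fun q => coil e q.fst (1 - q.snd), ?_, ?_, ?_⟩
  · have hfst := (continuous_fst.comp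
      (WithLp.prod_continuous_ofLp 2 (EuclideanSpace ℝ (Fin n)) ℝ))
    have hsnd := (continuous_snd.comp
      (WithLp.prod_continuous_ofLp 2 (EuclideanSpace ℝ (Fin n)) ℝ))
    exact ((continuous_coil e).comp (hfst.prodMk (continuous_const.sub hsnd))).continuousOn
  · subst hC
    rintro ⟨x, s⟩ hx ⟨y, t⟩ hy h
    simp only [WithLp.equiv_apply, Set.mem_ofPred_eq] at hx hy
    change coil e x (1 - s) = coil e y (1 - t) at h
    have hsub : ∀ r ∈ Set.Icc (0 : ℝ) 1, 1 - r ∈ Set.Icc (0 : ℝ) 1 := fun r hr =>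
      ⟨sub_nonneg.2 hr.2, sub_le_self _ hr.1⟩
    rcases hx with ⟨-, rfl⟩ | ⟨rfl, hs⟩
    · have ht : 1 - t ∈ Set.Icc (0 : ℝ) 1 := by
        rcases hy with ⟨-, rfl⟩ | ⟨-, ht⟩
        · simp
        · exact hsub t ht
      rw [sub_zero, coil_one_eq_coil_iff ht] at h
      obtain ⟨rfl, h⟩ := h
      rw [show t = 0 by linarith]
    · rcases hy with ⟨-, rfl⟩ | ⟨rfl, ht⟩
      · rw [sub_zero, eq_comm, coil_one_eq_coil_iff (hsub s hs)] at h
        obtain ⟨rfl, h⟩ := h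
        rw [show s = 0 by linarith]
      · rw [sub_right_injective (injOn_coil he _ (hsub s hs) (hsub t ht) h)]
  · rintro ⟨m, f, hf, hatt⟩
    rw [himage] at hatt
    exact coiledWedge_not_attractor he hAcomp (hpath a ha) f hf hatt
end

section
/- Let n ≥ 2. Define h₁ : ℝⁿ → ℝⁿ by h₁(x₁, …, xₙ) = (x₁, (x₁/100)·x₂, …, (x₁/100)·xₙ), and define h₂ : {y ∈ ℝⁿ : y₁ ≥ 0} → ℝⁿ by h₂(y₁, y₂, y₃, …, yₙ) = (y₁, √y₁ · sin(1/y₁) + y₂, y₃, …, yₙ) for y₁ > 0 and h₂(0, y₂, …, yₙ) = (0, y₂, …, yₙ). Let h = h₂ ∘ h₁ and Q = [0,1] × [−1,1]^{n−1}. Then h is continuous on Q, and h is injective on the set ((0,1] × [−1,1]^{n−1}) ∪ {0}; consequently h restricted to any compact set C ⊆ Q with C ∩ ({0} × ℝ^{n−1}) ⊆ {0} is a topological embedding. -/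
theorem Real.continuous_sqrt_mul_sin_inv :
    Continuous fun t : ℝ => Real.sqrt t * Real.sin t⁻¹ := by
  rw [continuous_iff_continuousAt]
  intro t
  rcases eq_or_ne t 0 with rfl | ht
  · have h0 : Filter.Tendsto Real.sqrt (nhds 0) (nhds 0) := by
      simpa using Real.continuous_sqrt.tendsto 0
    have := squeeze_zero_norm (f := fun t : ℝ => Real.sqrt t * Real.sin t⁻¹) (fun s => by
      rw [norm_mul, Real.norm_of_nonneg (Real.sqrt_nonneg s)]
      exact mul_le_of_le_one_right (Real.sqrt_nonneg s) (Real.abs_sin_le_one _)) h0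
    simpa [ContinuousAt] using this
  · exact Real.continuous_sqrt.continuousAt.mul
      (Real.continuous_sin.continuousAt.comp (continuousAt_inv₀ ht))


/-- For `n ≥ 2`, let `h₁(x₁,…,xₙ) = (x₁, (x₁/100)x₂, …, (x₁/100)xₙ)` and let
`h₂(y₁, y₂, y₃, …, yₙ) = (y₁, √y₁ sin(1/y₁) + y₂, y₃, …, yₙ)` for `y₁ > 0`, extended by
`h₂(0, y₂, …, yₙ) = (0, y₂, …, yₙ)`. Put `h = h₂ ∘ h₁` and `Q = [0,1] × [-1,1]^{n-1}`. Then
`h` is continuous on `Q`, injective on `((0,1] × [-1,1]^{n-1}) ∪ {0}`, and its restriction to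
any compact `C ⊆ Q` with `C ∩ ({0} × ℝ^{n-1}) ⊆ {0}` is a topological embedding. -/
theorem h_continuousOn_injOn_embedding (n : ℕ) (hn : 2 ≤ n)
    (h₁ h₂ : EuclideanSpace ℝ (Fin n) → EuclideanSpace ℝ (Fin n))
    (hh₁ : ∀ x : EuclideanSpace ℝ (Fin n), ∀ i : Fin n,
      h₁ x i = if i = ⟨0, by omega⟩ then x i else x ⟨0, by omega⟩ / 100 * x i)
    (hh₂pos : ∀ y : EuclideanSpace ℝ (Fin n), 0 < y ⟨0, by omega⟩ → ∀ i : Fin n,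
      h₂ y i = if i = ⟨1, by omega⟩ then
          Real.sqrt (y ⟨0, by omega⟩) * Real.sin (y ⟨0, by omega⟩)⁻¹ + y i
        else y i)
    (hh₂zero : ∀ y : EuclideanSpace ℝ (Fin n), y ⟨0, by omega⟩ = 0 → h₂ y = y)
    (Q : Set (EuclideanSpace ℝ (Fin n)))
    (hQ : Q = {x : EuclideanSpace ℝ (Fin n) | x ⟨0, by omega⟩ ∈ Set.Icc (0 : ℝ) 1 ∧
      ∀ i : Fin n, i ≠ ⟨0, by omega⟩ → x i ∈ Set.Icc (-1 : ℝ) 1}) :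
    ContinuousOn (h₂ ∘ h₁) Q ∧
    Set.InjOn (h₂ ∘ h₁)
      ({x : EuclideanSpace ℝ (Fin n) | x ⟨0, by omega⟩ ∈ Set.Ioc (0 : ℝ) 1 ∧
        ∀ i : Fin n, i ≠ ⟨0, by omega⟩ → x i ∈ Set.Icc (-1 : ℝ) 1} ∪ {0}) ∧
    ∀ C : Set (EuclideanSpace ℝ (Fin n)), C ⊆ Q → IsCompact C →
      C ∩ {x : EuclideanSpace ℝ (Fin n) | x ⟨0, by omega⟩ = 0} ⊆ {0} →
      Topology.IsEmbedding (fun c : C => (h₂ ∘ h₁) c) := by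
  have h_apply : ∀ x : EuclideanSpace ℝ (Fin n), 0 ≤ x ⟨0, by omega⟩ → ∀ i : Fin n,
      (h₂ ∘ h₁) x i = (if i = ⟨1, by omega⟩ then
        Real.sqrt (x ⟨0, by omega⟩) * Real.sin (x ⟨0, by omega⟩)⁻¹ else 0) +
        if i = ⟨0, by omega⟩ then x i else x ⟨0, by omega⟩ / 100 * x i := by
    intro x hx i
    have h₁_zero : h₁ x ⟨0, by omega⟩ = x ⟨0, by omega⟩ := by simp [hh₁]
    rcases hx.eq_or_lt with hx0 | hx0
    · rw [Function.comp_apply, hh₂zero _ (h₁_zero.trans hx0.symm), hh₁, ← hx0]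
      simp
    · rw [Function.comp_apply, hh₂pos _ (h₁_zero.symm ▸ hx0), h₁_zero, hh₁]
      split_ifs <;> simp
  have h_cont : ContinuousOn (h₂ ∘ h₁) Q := by
    refine (PiLp.continuous_toLp 2 _).comp_continuousOn
      (f := fun x i => (h₂ ∘ h₁) x i) (continuousOn_pi.2 fun i => ?_)
    refine ContinuousOn.congr (Continuous.continuousOn ?_)
      fun x hx => h_apply x (by rw [hQ] at hx; exact hx.1.1) i
    refine Continuous.add ?_ ?_
    · split_ifs
      · exact Real.continuous_sqrt_mul_sin_inv.comp (by fun_prop)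
      · exact continuous_const
    · split_ifs <;> fun_prop
  have h_inj : Set.InjOn (h₂ ∘ h₁)
      ({x : EuclideanSpace ℝ (Fin n) | x ⟨0, by omega⟩ ∈ Set.Ioc (0 : ℝ) 1 ∧
        ∀ i : Fin n, i ≠ ⟨0, by omega⟩ → x i ∈ Set.Icc (-1 : ℝ) 1} ∪ {0}) := by
    have h_nonneg_eq : ∀ x ∈ ({x : EuclideanSpace ℝ (Fin n) |
        x ⟨0, by omega⟩ ∈ Set.Ioc (0 : ℝ) 1 ∧
        ∀ i : Fin n, i ≠ ⟨0, by omega⟩ → x i ∈ Set.Icc (-1 : ℝ) 1} ∪ {0}),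
        0 ≤ x ⟨0, by omega⟩ ∧ (x ⟨0, by omega⟩ = 0 → x = 0) := by
      rintro x (hx | rfl)
      · exact ⟨hx.1.1.le, fun h => absurd h hx.1.1.ne'⟩
      · simp
    intro x hx y hy hxy
    obtain ⟨hx_nonneg, hx_zero⟩ := h_nonneg_eq x hx
    obtain ⟨hy_nonneg, hy_zero⟩ := h_nonneg_eq y hy
    have h_coord : ∀ i, (h₂ ∘ h₁) x i = (h₂ ∘ h₁) y i := fun i => by rw [hxy]
    have h_first : x ⟨0, by omega⟩ = y ⟨0, by omega⟩ := by
      have h0 := h_coord ⟨0, by omega⟩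
      rw [h_apply x hx_nonneg, h_apply y hy_nonneg] at h0
      simpa using h0
    by_cases hx0 : x ⟨0, by omega⟩ = 0
    · rw [hx_zero hx0, hy_zero (h_first ▸ hx0)]
    · ext i
      have hi := h_coord i
      rw [h_apply x hx_nonneg, h_apply y hy_nonneg, ← h_first, add_right_inj] at hi
      split_ifs at hi
      · exact hi
      · exact mul_left_cancel₀ (div_ne_zero hx0 (by norm_num)) hi
  refine ⟨h_cont, h_inj, fun C hCQ hC hC0 => ?_⟩
  have : CompactSpace C := isCompact_iff_compactSpace.1 hC
  refine ((h_cont.mono hCQ).domRestrict.isClosedEmbedding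
    (Set.injOn_iff_injective.1 (h_inj.mono fun x hx => ?_))).isEmbedding
  have hxQ := hCQ hx
  rw [hQ] at hxQ
  rcases hxQ.1.1.eq_or_lt with h0 | h0
  · exact Or.inr (hC0 ⟨hx, h0.symm⟩)
  · exact Or.inl ⟨⟨h0, hxQ.1.2⟩, hxQ.2⟩
end

section
/- Let n ≥ 2. Define h₁ : ℝⁿ → ℝⁿ by h₁(x₁, …, xₙ) = (x₁, (x₁/100)·x₂, …, (x₁/100)·xₙ), and define h₂ : {y ∈ ℝⁿ : y₁ ≥ 0} → ℝⁿ by h₂(y₁, y₂, y₃, …, yₙ) = (y₁, √y₁ · sin(1/y₁) + y₂, y₃, …, yₙ) for y₁ > 0 and h₂(0, y₂, …, yₙ) = (0, y₂, …, yₙ). Let h = h₂ ∘ h₁, Q = [0,1] × [−1,1]^{n−1}, and S = h(Q). Then for every x ∈ S with x ≠ 0, one has d̃(x, 0, S) = ∞ (note h(0) = 0 ∈ S). -/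
open scoped ENNReal NNReal

theorem not_summable_sqrt_inv_pi_div_two_add_nat_mul_pi :
    ¬ Summable fun k : ℕ => Real.sqrt (Real.pi / 2 + k * Real.pi)⁻¹ := by
  intro h
  refine Real.not_summable_one_div_natCast ((summable_nat_add_iff 1).1 ?_)
  refine (h.mul_left 4).of_nonneg_of_le (fun k => by positivity) fun k => ?_
  have hk : (0 : ℝ) ≤ k := k.cast_nonneg
  have hpos : 0 < Real.pi / 2 + k * Real.pi := by positivity
  have hle : Real.pi / 2 + k * Real.pi ≤ 4 * (k + 1) := by
    nlinarith [Real.pi_le_four, Real.pi_pos]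
  have hone : 1 ≤ Real.pi / 2 + k * Real.pi := by
    nlinarith [Real.pi_gt_three, mul_nonneg hk Real.pi_pos.le]
  have hsqrt : (Real.pi / 2 + k * Real.pi)⁻¹ ≤ Real.sqrt (Real.pi / 2 + k * Real.pi)⁻¹ := by
    apply Real.le_sqrt_of_sq_le
    have h0 : 0 < (Real.pi / 2 + k * Real.pi)⁻¹ := inv_pos.2 hpos
    nlinarith [inv_le_one_of_one_le₀ hone]
  have hinv : (4 * ((k : ℝ) + 1))⁻¹ ≤ (Real.pi / 2 + k * Real.pi)⁻¹ := inv_anti₀ hpos hle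
  rw [mul_inv] at hinv
  push_cast
  rw [one_div]
  linarith

theorem sum_dist_comp_monotone_le {α : Type*} [PseudoMetricSpace α] (g : ℕ → α) {i : ℕ → ℕ}
    (hi : Monotone i) (M : ℕ) :
    ∑ k ∈ Finset.range M, dist (g (i k)) (g (i (k + 1))) ≤
      ∑ j ∈ Finset.range (i M), dist (g j) (g (j + 1)) := by
  induction M with
  | zero => simpa using Finset.sum_nonneg fun _ _ => dist_nonneg
  | succ M ih =>
    rw [Finset.sum_range_succ, ← Finset.sum_range_add_sum_Ico _ (hi M.le_succ)]
    exact add_le_add ih (dist_le_Ico_sum_dist g (hi M.le_succ))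

theorem exists_forall_abs_sub_lt_imp_near_peak (m : ℕ) :
    ∃ δ > 0, ∀ t : ℝ, |t - (Real.pi / 2 + m * Real.pi)⁻¹| < δ → 0 < t ∧
      |Real.sqrt t * Real.sin t⁻¹ - (-1) ^ m * Real.sqrt (Real.pi / 2 + m * Real.pi)⁻¹| + t / 100
        ≤ Real.sqrt (Real.pi / 2 + m * Real.pi)⁻¹ / 2 := by
  have hk : (0 : ℝ) ≤ m := m.cast_nonneg
  have hsin : Real.sin (Real.pi / 2 + m * Real.pi) = (-1) ^ m := by
    rw [Real.sin_add_nat_mul_pi, Real.sin_pi_div_two, mul_one]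
  have hone : 1 ≤ Real.pi / 2 + m * Real.pi := by
    nlinarith [Real.pi_gt_three, mul_nonneg hk Real.pi_pos.le]
  generalize Real.pi / 2 + m * Real.pi = r at *
  have hr : 0 < r⁻¹ := by positivity
  have hsqrt : r⁻¹ ≤ Real.sqrt r⁻¹ := by
    apply Real.le_sqrt_of_sq_le
    nlinarith [inv_le_one_of_one_le₀ hone]
  have hcont : ContinuousAt (fun t : ℝ =>
      |Real.sqrt t * Real.sin t⁻¹ - (-1) ^ m * Real.sqrt r⁻¹| + t / 100) r⁻¹ := by
    have := continuousAt_inv₀ hr.ne'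
    fun_prop
  have hlt := hcont.eventually_lt (continuousAt_const (y := Real.sqrt r⁻¹ / 2)) (by
    simp only [inv_inv, hsin]
    rw [mul_comm, sub_self, abs_zero]
    linarith)
  obtain ⟨δ, hδ, h⟩ := Metric.eventually_nhds_iff.1 (hlt.and (eventually_gt_nhds hr))
  exact ⟨δ, hδ, fun t ht => ⟨(h ht).2, (h ht).1.le⟩⟩

open Filter Topology in
/-- A chain of plane points close to the graph of `t ↦ √t sin (1/t)` with first coordinates going
from at least `a > 0` down to `0` in small steps has large vertical variation. -/
theorem exists_le_sum_dist_of_near_graph {a : ℝ} (ha : 0 < a) (C : ℝ) :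
    ∃ ε > 0, ∀ (N : ℕ) (p q : ℕ → ℝ),
      (∀ j, 0 < p j → |q j - Real.sqrt (p j) * Real.sin (p j)⁻¹| ≤ p j / 100) →
      a ≤ p 0 → p N = 0 → (∀ j < N, |p j - p (j + 1)| < ε) →
      C ≤ ∑ j ∈ Finset.range N, dist (q j) (q (j + 1)) := by
  set t : ℕ → ℝ := fun m => (Real.pi / 2 + m * Real.pi)⁻¹ with ht
  have htpos (m : ℕ) : 0 < t m := by have := Real.pi_pos; positivity
  have htanti : Antitone t := fun m m' h => by
    have := Real.pi_pos
    have : (m : ℝ) ≤ m' := by exact_mod_cast h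
    simp only [ht]
    gcongr
  obtain ⟨K, hK⟩ : ∃ K, t K ≤ a := by
    obtain ⟨K, hK⟩ := exists_nat_gt a⁻¹
    refine ⟨K, inv_le_of_inv_le₀ ha ?_⟩
    nlinarith [Real.pi_gt_three, (Nat.cast_nonneg K : (0 : ℝ) ≤ K)]
  obtain ⟨M, hM⟩ : ∃ M, 2 * C ≤ ∑ k ∈ Finset.range M, Real.sqrt (t (k + K)) := by
    have hns : ¬ Summable fun k => Real.sqrt (t (k + K)) := fun h =>
      not_summable_sqrt_inv_pi_div_two_add_nat_mul_pi ((summable_nat_add_iff K).1 h)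
    have := (not_summable_iff_tendsto_nat_atTop_of_nonneg fun k => Real.sqrt_nonneg _).1 hns
    exact (this.eventually_ge_atTop (2 * C)).exists
  choose δ hδ hpeak using exists_forall_abs_sub_lt_imp_near_peak
  obtain ⟨ε, hεδ, hε⟩ : ∃ ε, (∀ k ∈ Finset.range (M + 1), ε < δ (k + K)) ∧ 0 < ε := by
    have hsmall : ∀ᶠ ε : ℝ in 𝓝[>] 0, ∀ k ∈ Finset.range (M + 1), ε < δ (k + K) :=
      (Finset.eventually_all _).2 fun k _ =>
        eventually_nhdsWithin_of_eventually_nhds (eventually_lt_nhds (hδ (k + K)))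
    exact (hsmall.and self_mem_nhdsWithin).exists
  refine ⟨ε, hε, fun N p q hpq hp0 hpN hstep => ?_⟩
  set i : ℕ → ℕ := fun k => Nat.findGreatest (fun j => t (k + K) ≤ p j) N with hi
  have hmono : Monotone i := fun k k' h =>
    Nat.findGreatest_mono_left (fun j hj => (htanti (by omega)).trans hj) N
  have hiN (k : ℕ) : i k ≤ N := Nat.findGreatest_le N
  have hnear : ∀ k ∈ Finset.range (M + 1),
      |q (i k) - (-1) ^ (k + K) * Real.sqrt (t (k + K))| ≤ Real.sqrt (t (k + K)) / 2 := by
    intro k hk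
    have hspec : t (k + K) ≤ p (i k) :=
      Nat.findGreatest_spec (P := fun j => t (k + K) ≤ p j) (Nat.zero_le N)
        ((htanti (Nat.le_add_left K k)).trans (hK.trans hp0))
    have hlt : i k < N := by
      refine (hiN k).lt_of_ne fun h => ?_
      rw [h, hpN] at hspec
      exact (htpos _).not_ge hspec
    have hnext : p (i k + 1) < t (k + K) := not_le.1 <|
      Nat.findGreatest_is_greatest (P := fun j => t (k + K) ≤ p j) (Nat.lt_succ_self _) hlt
    obtain ⟨hpos, hle⟩ := hpeak (k + K) (p (i k)) (by
      have := (abs_lt.1 (hstep _ hlt)).2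
      have := hεδ k hk
      change |p (i k) - t (k + K)| < _
      rw [abs_of_nonneg (by linarith)]
      linarith)
    have := abs_sub_le (q (i k)) (Real.sqrt (p (i k)) * Real.sin (p (i k))⁻¹)
      ((-1) ^ (k + K) * Real.sqrt (t (k + K)))
    have := hpq _ hpos
    simp only [ht] at *
    linarith
  have hjump : ∀ k ∈ Finset.range M,
      Real.sqrt (t (k + K)) / 2 ≤ dist (q (i k)) (q (i (k + 1))) := by
    intro k hk
    have hkM := Finset.mem_range.1 hk
    have h1 := abs_le.1 (hnear k (Finset.mem_range.2 (by omega)))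
    have h2 := abs_le.1 (hnear (k + 1) (Finset.mem_range.2 (by omega)))
    have h3 := Real.sqrt_nonneg (t (k + 1 + K))
    rw [show k + 1 + K = k + K + 1 by ring, pow_succ] at h2
    rw [show k + 1 + K = k + K + 1 by ring] at h3
    rw [Real.dist_eq]
    rcases neg_one_pow_eq_or ℝ (k + K) with h | h <;> rw [h] at h1 h2
    · exact le_trans (by linarith) (le_abs_self _)
    · exact le_trans (by linarith) (neg_le_abs _)
  calc C ≤ ∑ k ∈ Finset.range M, Real.sqrt (t (k + K)) / 2 := by
        rw [← Finset.sum_div]; linarith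
    _ ≤ ∑ k ∈ Finset.range M, dist (q (i k)) (q (i (k + 1))) := Finset.sum_le_sum hjump
    _ ≤ ∑ j ∈ Finset.range (i M), dist (q j) (q (j + 1)) := sum_dist_comp_monotone_le q hmono M
    _ ≤ _ := Finset.sum_le_sum_of_subset_of_nonneg (Finset.range_mono (hiN M))
        fun _ _ _ => dist_nonneg

/-- For `n ≥ 2`, with `h₁`, `h₂`, `h = h₂ ∘ h₁` and `Q = [0,1] × [-1,1]^{n-1}`
as before, and `S = h(Q)`, every `x ∈ S` with `x ≠ 0` satisfies `d̃(x, 0, S) = ∞`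
(note `h(0) = 0 ∈ S`). -/
theorem chainDist_to_origin_eq_top (n : ℕ) (hn : 2 ≤ n)
    (h₁ h₂ : EuclideanSpace ℝ (Fin n) → EuclideanSpace ℝ (Fin n))
    (hh₁ : ∀ x : EuclideanSpace ℝ (Fin n), ∀ i : Fin n,
      h₁ x i = if i = ⟨0, by omega⟩ then x i else x ⟨0, by omega⟩ / 100 * x i)
    (hh₂pos : ∀ y : EuclideanSpace ℝ (Fin n), 0 < y ⟨0, by omega⟩ → ∀ i : Fin n,
      h₂ y i = if i = ⟨1, by omega⟩ then
          Real.sqrt (y ⟨0, by omega⟩) * Real.sin (y ⟨0, by omega⟩)⁻¹ + y i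
        else y i)
    (hh₂zero : ∀ y : EuclideanSpace ℝ (Fin n), y ⟨0, by omega⟩ = 0 → h₂ y = y)
    (Q : Set (EuclideanSpace ℝ (Fin n)))
    (hQ : Q = {x : EuclideanSpace ℝ (Fin n) | x ⟨0, by omega⟩ ∈ Set.Icc (0 : ℝ) 1 ∧
      ∀ i : Fin n, i ≠ ⟨0, by omega⟩ → x i ∈ Set.Icc (-1 : ℝ) 1})
    (S : Set (EuclideanSpace ℝ (Fin n))) (hS : S = (h₂ ∘ h₁) '' Q) :
    ∀ x ∈ S, x ≠ 0 → chainDist S x 0 = ⊤ := by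
  have h10 : (⟨1, by omega⟩ : Fin n) ≠ ⟨0, by omega⟩ := by simp
  have hgraph : ∀ z ∈ S, 0 < z ⟨0, by omega⟩ →
      |z ⟨1, by omega⟩ - Real.sqrt (z ⟨0, by omega⟩) * Real.sin (z ⟨0, by omega⟩)⁻¹|
        ≤ z ⟨0, by omega⟩ / 100 := by
    subst hS hQ
    rintro _ ⟨w, ⟨hw0, hw⟩, rfl⟩ hpos
    have hw1 := hw _ h10
    have e0 : h₁ w ⟨0, by omega⟩ = w ⟨0, by omega⟩ := by rw [hh₁, if_pos rfl]
    have e1 : h₁ w ⟨1, by omega⟩ = w ⟨0, by omega⟩ / 100 * w ⟨1, by omega⟩ := by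
      rw [hh₁, if_neg h10]
    rcases hw0.1.eq_or_lt with h | h
    · rw [Function.comp_apply, hh₂zero _ (e0.trans h.symm), e0] at hpos
      exact absurd h hpos.ne
    · have e2 := hh₂pos (h₁ w) (by rwa [e0])
      rw [Function.comp_apply, e2, e2, if_pos rfl, if_neg h10.symm, e0, e1, add_sub_cancel_left,
        abs_mul, abs_of_pos (by positivity)]
      exact mul_le_of_le_one_right (by positivity) (abs_le.2 hw1)
  have hpos : ∀ z ∈ S, z ≠ 0 → 0 < z ⟨0, by omega⟩ := by
    subst hS hQ
    rintro _ ⟨w, ⟨hw0, hw⟩, rfl⟩ hne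
    have e0 : h₁ w ⟨0, by omega⟩ = w ⟨0, by omega⟩ := by rw [hh₁, if_pos rfl]
    rcases hw0.1.eq_or_lt with h | h
    · refine absurd ?_ hne
      rw [Function.comp_apply, hh₂zero _ (e0.trans h.symm)]
      ext i
      rw [hh₁]
      split_ifs with hi
      · rw [hi, ← h]; rfl
      · rw [← h]; simp
    · rwa [Function.comp_apply, hh₂pos (h₁ w) (by rwa [e0]), if_neg h10.symm, e0]
  intro x hx hx0
  refine ENNReal.eq_top_of_forall_nnreal_le fun C => ?_
  obtain ⟨ε, hε, hchain⟩ := exists_le_sum_dist_of_near_graph (hpos x hx hx0) C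
  refine le_iSup₂_of_le ε hε ?_
  refine le_iInf fun N => le_iInf fun c => le_iInf fun hc0 => le_iInf fun hcN => le_iInf fun hcS =>
    le_iInf fun hstep => ?_
  set g : ℕ → EuclideanSpace ℝ (Fin n) := fun j => c ⟨min j N, by omega⟩ with hg
  have hcast (j : Fin N) : g j = c j.castSucc := by
    simp only [hg]; congr 1; ext; simp [j.2.le]
  have hsucc (j : Fin N) : g (j + 1) = c j.succ := by
    simp only [hg]; congr 1; ext; simp [Nat.succ_le_of_lt j.2]
  have hcoord (u v : EuclideanSpace ℝ (Fin n)) (i : Fin n) : dist (u i) (v i) ≤ dist u v := by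
    rw [dist_eq_norm, dist_eq_norm]
    exact PiLp.norm_apply_le (u - v) i
  have hC := hchain N (fun j => g j ⟨0, by omega⟩) (fun j => g j ⟨1, by omega⟩)
    (fun j hj => hgraph _ (hcS _) hj)
    (by
      have : g 0 = x := by rw [← hc0]; simp only [hg]; congr 1
      rw [this])
    (by
      have : g N = 0 := by rw [← hcN]; simp only [hg]; congr 1; ext; simp
      simp [this])
    (fun j hj => by
      have h := hstep ⟨j, hj⟩
      rw [← hcast, ← hsucc] at h
      exact (hcoord _ _ _).trans_lt h)
  rw [← ENNReal.ofReal_sum_of_nonneg fun _ _ => dist_nonneg, ← ENNReal.ofReal_coe_nnreal]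
  apply ENNReal.ofReal_le_ofReal
  refine hC.trans ?_
  rw [← Fin.sum_univ_eq_sum_range
    (fun j => dist (g j ⟨1, by omega⟩) (g (j + 1) ⟨1, by omega⟩)) N]
  refine Finset.sum_le_sum fun j _ => ?_
  rw [← hcast, ← hsucc]
  exact hcoord _ _ _
end
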